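/- arXiv:2603.17992 — 8 statements merged into one kernel-verified Lean document; each statement's English description precedes it below -/
import Mathlib

section
/- Ritt's Cycle Trick: Let A = (a_{i,j}) be an n×n matrix with entries in ℤ ∪ {−∞} such that tdet(A) = ∑_{i=1}^n a_{i,i} and a_{i,i} ≠ −∞ for every i. Then for every permutation τ ∈ S_n one has ∑_{i ∈ supp(τ)} a_{i,τ(i)} ≤ ∑_{i ∈ supp(τ)} a_{i,i}; in particular, for every cycle τ = (i₁ i₂ … i_s), the cyclic sum a_τ = a_{i₁,i₂} + a_{i₂,i₃} + ⋯ + a_{i_s,i₁} satisfies a_τ ≤ a_{i₁,i₁} + a_{i₂,i₂} + ⋯ + a_{i_s,i_s}. -/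
/-- The tropical determinant of a square matrix with entries in `ℤ ∪ {−∞}`:
the maximum over all permutations `ρ` of the transversal `∑ i, A i (ρ i)`. -/
noncomputable def tdet {ι : Type*} [Fintype ι] [DecidableEq ι]
    (A : Matrix ι ι (WithBot ℤ)) : WithBot ℤ :=
  Finset.univ.sup fun ρ : Equiv.Perm ι => ∑ i, A i (ρ i)

/-- **Ritt's Cycle Trick.** If the tropical determinant of `A` is attained along the
diagonal and all diagonal entries are finite, then for every permutation `τ` the sum
of the entries `A i (τ i)` over the support of `τ` is bounded by the corresponding
diagonal sum.  In particular, for a cycle `τ = (i₁ i₂ … i_s)` the cyclic sum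
`a_{i₁,i₂} + a_{i₂,i₃} + ⋯ + a_{i_s,i₁}` is at most `a_{i₁,i₁} + ⋯ + a_{i_s,i_s}`. -/
theorem ritt_cycle_trick (n : ℕ) (A : Matrix (Fin n) (Fin n) (WithBot ℤ))
    (hA : tdet A = ∑ i, A i i) (hdiag : ∀ i, A i i ≠ ⊥)
    (τ : Equiv.Perm (Fin n)) :
    ∑ i ∈ τ.support, A i (τ i) ≤ ∑ i ∈ τ.support, A i i := by
  have hle : ∑ i, A i (τ i) ≤ ∑ i, A i i :=
    hA ▸ Finset.le_sup (f := fun ρ : Equiv.Perm (Fin n) => ∑ i, A i (ρ i)) (Finset.mem_univ τ)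
  have hfix : ∑ i ∈ τ.supportᶜ, A i (τ i) = ∑ i ∈ τ.supportᶜ, A i i :=
    Finset.sum_congr rfl fun i hi => by
      rw [Equiv.Perm.notMem_support.mp (Finset.mem_compl.mp hi)]
  have hfin : ∑ i ∈ τ.supportᶜ, A i i ≠ ⊥ := by
    simpa [WithBot.sum_eq_bot_iff] using fun i _ => hdiag i
  rw [← Finset.sum_add_sum_compl τ.support, ← Finset.sum_add_sum_compl τ.support, hfix] at hle
  exact (WithBot.add_le_add_iff_right hfin).mp hle
end

section
/- (Order-matrix content of reduction from Ritt's first form.) Let n ≥ 2 and let A = (a_{i,j}) and B = (b_{i,j}) be n×n matrices with entries in ℤ ∪ {−∞}. Assume: (i) tdet(A) = ∑_{i=1}^n a_{i,i} and a_{i,i} ≠ −∞ for all i; (ii) a_{2,1} ≥ a_{1,1}; (iii) b_{i,j} = a_{i,j} for all j whenever i ≠ 2; (iv) for every j, b_{2,j} + a_{1,1} ≤ max(a_{2,j} + a_{1,1}, a_{1,j} + a_{2,1}) (since a_{1,1} is finite, this says b_{2,j} ≤ max(a_{2,j}, a_{1,j} + a_{2,1} − a_{1,1}), the inequality satisfied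 by the order matrix after Ritt ∂-division of u₂ by u₁ in the first variable). Then tdet(B) ≤ tdet(A). -/
open Equiv in
/-- Composing with the transposition of two points of one cycle splits that cycle. -/
theorem Equiv.Perm.SameCycle.not_sameCycle_mul_swap {α : Type*} [Finite α] [DecidableEq α]
    {ρ : Perm α} {a b : α} (h : ρ.SameCycle a b) (hab : a ≠ b) :
    ¬ (ρ * swap a b).SameCycle b a := by
  classical
  have hex : ∃ k : ℕ, (ρ ^ k) a = b := h.exists_nat_pow_eq
  obtain ⟨k, hk, hmin⟩ : ∃ k : ℕ, (ρ ^ k) a = b ∧ ∀ m < k, (ρ ^ m) a ≠ b :=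
    ⟨Nat.find hex, Nat.find_spec hex, fun m hm => Nat.find_min hex hm⟩
  have hk0 : 0 < k := by
    rcases Nat.eq_zero_or_pos k with rfl | hpos
    · exact absurd (by simpa using hk) hab
    · exact hpos
  have hne : ∀ m, 0 < m → m < k → (ρ ^ m) a ≠ a := by
    intro m hm hmk hma
    apply hmin (k - m) (by omega)
    rw [← hk]
    conv_rhs => rw [← Nat.sub_add_cancel hmk.le, pow_add, Perm.mul_apply, hma]
  have hpow : ∀ m, m + 1 ≤ k → ((ρ * swap a b) ^ (m + 1)) b = (ρ ^ (m + 1)) a := by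
    intro m
    induction m with
    | zero => simp
    | succ m ih =>
      intro hm
      rw [pow_succ', Perm.mul_apply, ih (by omega), Perm.mul_apply,
        swap_apply_of_ne_of_ne (hne _ (by omega) (by omega)) (hmin _ (by omega)),
        ← Perm.mul_apply, ← pow_succ']
  have hper : ((ρ * swap a b) ^ k) b = b := by
    obtain ⟨m, rfl⟩ := Nat.exists_eq_succ_of_ne_zero hk0.ne'
    exact (hpow m le_rfl).trans hk
  intro hs
  obtain ⟨j, hj⟩ := hs.exists_nat_pow_eq
  have hmod : ((ρ * swap a b) ^ (j % k)) b = a := by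
    rw [← Nat.mod_add_div j k, pow_add, Perm.mul_apply, pow_mul,
      Perm.pow_apply_eq_self_of_apply_eq_self hper] at hj
    exact hj
  have hlt := Nat.mod_lt j hk0
  rcases hm : j % k with _ | m
  · rw [hm] at hmod
    exact hab (by simpa using hmod.symm)
  · rw [hm] at hmod hlt
    rw [hpow m hlt.le] at hmod
    exact hne _ (by omega) hlt hmod

theorem sum_le_tdet {ι : Type*} [Fintype ι] [DecidableEq ι]
    (A : Matrix ι ι (WithBot ℤ)) (σ : Equiv.Perm ι) : ∑ i, A i (σ i) ≤ tdet A :=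
  Finset.le_sup (f := fun ρ : Equiv.Perm ι => ∑ i, A i (ρ i)) (Finset.mem_univ σ)

open Equiv in
/-- If `0` and `1` lie in different cycles of `τ`, the edges `i ↦ τ i` together with a second
edge out of `0` (to `τ 1`), the edge `1 ↦ 0` and loops decompose into two permutations. -/
theorem sum_add_sum_le_tdet_add_tdet {n : ℕ}
    (A : Matrix (Fin (n + 2)) (Fin (n + 2)) (WithBot ℤ)) {τ : Perm (Fin (n + 2))}
    (hτ : ¬ τ.SameCycle 0 1) :
    (A 0 (τ 0) + A 0 (τ 1)) + (A 1 1 + A 1 0) +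
      ∑ i : Fin n, (A i.succ.succ (τ i.succ.succ) + A i.succ.succ i.succ.succ) ≤
      tdet A + tdet A := by
  classical
  set σ := τ.cycleOf 0
  have hin : ∀ i, τ.SameCycle 0 i → σ i = τ i ∧ σ⁻¹ (τ i) = i := by
    intro i hi
    have h : σ i = τ i := hi.cycleOf_apply
    exact ⟨h, Perm.inv_eq_iff_eq.2 h.symm⟩
  have hout : ∀ i, ¬ τ.SameCycle 0 i → σ i = i ∧ σ⁻¹ (τ i) = τ i := by
    intro i hi
    refine ⟨Perm.cycleOf_apply_of_not_sameCycle hi, ?_⟩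
    rw [Perm.inv_eq_iff_eq]
    exact (Perm.cycleOf_apply_of_not_sameCycle
      (fun h => hi (Perm.sameCycle_apply_right.1 h))).symm
  have h0 := hin 0 (Perm.SameCycle.refl _ _)
  have h1 := hout 1 hτ
  refine le_trans (le_of_eq ?_)
    (add_le_add (sum_le_tdet A σ) (sum_le_tdet A (σ⁻¹ * τ * swap 0 1)))
  rw [← Finset.sum_add_distrib, Fin.sum_univ_succ, Fin.sum_univ_succ]
  refine (congrArg₂ (· + ·) ?_ ?_).trans (add_assoc _ _ _)
  · simp only [Perm.mul_apply, Fin.succ_zero_eq_one, swap_apply_left, swap_apply_right,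
      h0.1, h0.2, h1.1, h1.2]
  · refine Finset.sum_congr rfl fun i _ => ?_
    have hi : swap (0 : Fin (n + 2)) 1 i.succ.succ = i.succ.succ :=
      swap_apply_of_ne_of_ne (Fin.succ_ne_zero _)
        (fun h => Fin.succ_ne_zero i (Fin.succ_injective _ h))
    simp only [Perm.mul_apply, hi]
    by_cases hs : τ.SameCycle 0 i.succ.succ
    · rw [(hin _ hs).1, (hin _ hs).2]
    · rw [(hout _ hs).1, (hout _ hs).2, add_comm]

/-- **Order-matrix content of the reduction from Ritt's first form.**
Indices are `0`-based: rows/columns `0` and `1` play the roles of `1` and `2`,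
and the matrices have size `n + 2 ≥ 2`.  Suppose the tropical determinant of `A`
is attained along the diagonal with all diagonal entries finite (Ritt's first
form, together with `A 0 0 ≤ A 1 0`), that `B` agrees with `A` except in row `1`,
and that row `1` of `B` satisfies the Ritt-division inequality
`b_{2,j} ≤ max (a_{2,j}, a_{1,j} + a_{2,1} − a_{1,1})` (written additively to avoid
subtraction in `ℤ ∪ {−∞}`).  Then `tdet B ≤ tdet A`. -/
theorem ritt_first_reduction (n : ℕ)
    (A B : Matrix (Fin (n + 2)) (Fin (n + 2)) (WithBot ℤ))
    (hA : tdet A = ∑ i, A i i) (hdiag : ∀ i, A i i ≠ ⊥)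
    (h21 : A 0 0 ≤ A 1 0)
    (hB : ∀ i, i ≠ 1 → ∀ j, B i j = A i j)
    (hdiv : ∀ j, B 1 j + A 0 0 ≤ max (A 1 j + A 0 0) (A 0 j + A 1 0)) :
    tdet B ≤ tdet A := by
  have hne1 : ∀ i : Fin n, i.succ.succ ≠ (1 : Fin (n + 2)) :=
    fun i h => Fin.succ_ne_zero i (Fin.succ_injective _ h)
  have hfin : tdet A ≠ ⊥ := by
    rw [hA]
    simpa [WithBot.sum_eq_bot_iff] using hdiag
  refine Finset.sup_le fun ρ _ => ?_
  rcases le_max_iff.1 (hdiv (ρ 1)) with h | h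
  · have h1 : B 1 (ρ 1) ≤ A 1 (ρ 1) := WithBot.le_of_add_le_add_right (hdiag 0) h
    refine le_trans (Finset.sum_le_sum fun i _ => ?_) (sum_le_tdet A ρ)
    rcases eq_or_ne i 1 with rfl | hi
    · exact h1
    · exact (hB i hi _).le
  · have key : (A 0 (ρ 0) + A 0 (ρ 1)) + (A 1 1 + A 1 0) +
        ∑ i : Fin n, (A i.succ.succ (ρ i.succ.succ) + A i.succ.succ i.succ.succ) ≤
        tdet A + tdet A := by
      by_cases hs : ρ.SameCycle 0 1
      · have hsplit := hs.not_sameCycle_mul_swap (by simp)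
        have := sum_add_sum_le_tdet_add_tdet A (fun h => hsplit h.symm)
        simpa [Equiv.swap_apply_of_ne_of_ne (Fin.succ_ne_zero _) (hne1 _),
          add_comm (A 0 (ρ 1))] using this
      · exact sum_add_sum_le_tdet_add_tdet A hs
    refine WithBot.le_of_add_le_add_right hfin (le_trans ?_ key)
    rw [hA, ← Finset.sum_add_distrib, Fin.sum_univ_succ, Fin.sum_univ_succ, ← add_assoc]
    refine add_le_add ?_ (Finset.sum_le_sum fun i _ => by rw [hB _ (hne1 i)])
    rw [hB 0 (by simp), Fin.succ_zero_eq_one]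
    calc A 0 (ρ 0) + A 0 0 + (B 1 (ρ 1) + A 1 1)
        = A 0 (ρ 0) + A 1 1 + (B 1 (ρ 1) + A 0 0) := by ac_rfl
      _ ≤ A 0 (ρ 0) + A 1 1 + (A 0 (ρ 1) + A 1 0) := by gcongr
      _ = A 0 (ρ 0) + A 0 (ρ 1) + (A 1 1 + A 1 0) := by ac_rfl
end

section
/- Existence of Ritt's first form: Let n ≥ 2 and let A = (a_{i,j}) be an n×n matrix with entries in ℤ ∪ {−∞} with tdet(A) ≠ −∞. Suppose that for every ρ ∈ S_n with tdet(A) = ∑_{i=1}^n a_{i,ρ(i)}, the entry of this maximal transversal lying in the first column, namely a_{ρ⁻¹(1),1}, is ≠ −∞ and is not a strict maximum of the first column, i.e. there exists i ≠ ρ⁻¹(1) with a_{i,1} ≥ a_{ρ⁻¹(1),1}. Then there exist permutations σ, τ ∈ S_n with τ(1) = 1 (the column permutation does not move the first column) such that the matrix C with c_{i,j} = a_{σ(i),τ(j)} is in Ritt's first form: tdet(C) = ∑_{i=1}^n c_{i,i}, c_{2,1} ≥ c_{1,1}, and c_{1,1} ≠ −∞. -/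
/-- Permuting rows and columns does not change the tropical determinant. -/
theorem tdet_submatrix {ι : Type*} [Fintype ι] [DecidableEq ι]
    (A : Matrix ι ι (WithBot ℤ)) (σ τ : Equiv.Perm ι) :
    tdet (A.submatrix σ τ) = tdet A := by
  have key : ∀ (B : Matrix ι ι (WithBot ℤ)) (σ τ : Equiv.Perm ι),
      tdet (B.submatrix σ τ) ≤ tdet B := by
    intro B σ τ
    refine Finset.sup_le fun ρ _ => ?_
    have h : ∑ i, B.submatrix σ τ i (ρ i) = ∑ i, B i ((τ * ρ * σ⁻¹) i) := by
      rw [← Equiv.sum_comp σ fun i => B i ((τ * ρ * σ⁻¹) i)]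
      simp
    rw [h]
    exact Finset.le_sup (f := fun π : Equiv.Perm ι => ∑ i, B i (π i)) (Finset.mem_univ _)
  refine le_antisymm (key A σ τ) ?_
  have h : (A.submatrix σ τ).submatrix ⇑σ⁻¹ ⇑τ⁻¹ = A := by
    ext i j
    simp
  simpa only [h] using key (A.submatrix σ τ) σ⁻¹ τ⁻¹

/-- The tropical determinant is realized by some transversal. -/
theorem exists_tdet_eq_sum {ι : Type*} [Fintype ι] [DecidableEq ι]
    (A : Matrix ι ι (WithBot ℤ)) :
    ∃ ρ : Equiv.Perm ι, tdet A = ∑ i, A i (ρ i) := by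
  obtain ⟨ρ, -, h⟩ := Finset.exists_mem_eq_sup Finset.univ Finset.univ_nonempty
    fun ρ : Equiv.Perm ι => ∑ i, A i (ρ i)
  exact ⟨ρ, h⟩

/-- Two distinct points can be moved to any two distinct points by a permutation. -/
theorem exists_perm_apply_eq_apply_eq {ι : Type*} [DecidableEq ι] {a b k i : ι}
    (hab : a ≠ b) (hki : k ≠ i) : ∃ σ : Equiv.Perm ι, σ a = k ∧ σ b = i := by
  refine ⟨Equiv.swap (Equiv.swap a k b) i * Equiv.swap a k, ?_, by simp⟩
  rw [Equiv.Perm.mul_apply, Equiv.swap_apply_left]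
  refine Equiv.swap_apply_of_ne_of_ne (fun h => hab ?_) hki
  exact (Equiv.swap a k).injective ((Equiv.swap_apply_left a k).trans h)

/-- **Existence of Ritt's first form.**  Indices are `0`-based and the matrix has size
`n + 2 ≥ 2`.  Suppose `tdet A ≠ −∞` and that for every permutation `ρ` realizing the
tropical determinant, the entry of the maximal transversal in the first column,
`A (ρ⁻¹ 0) 0`, is finite and is not a strict maximum of the first column.  Then `A` can
be brought into Ritt's first form by a row permutation `σ` and a column permutation `τ`
fixing the first column: the matrix `C i j = A (σ i) (τ j)` satisfies
`tdet C = ∑ i, C i i`, `C 1 0 ≥ C 0 0` and `C 0 0 ≠ −∞`. -/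
theorem exists_ritt_first_form (n : ℕ)
    (A : Matrix (Fin (n + 2)) (Fin (n + 2)) (WithBot ℤ))
    (htop : tdet A ≠ ⊥)
    (hyp : ∀ ρ : Equiv.Perm (Fin (n + 2)), tdet A = ∑ i, A i (ρ i) →
      A (ρ⁻¹ 0) 0 ≠ ⊥ ∧ ∃ i, i ≠ ρ⁻¹ 0 ∧ A (ρ⁻¹ 0) 0 ≤ A i 0) :
    ∃ (σ τ : Equiv.Perm (Fin (n + 2)))
      (C : Matrix (Fin (n + 2)) (Fin (n + 2)) (WithBot ℤ)),
      τ 0 = 0 ∧ (∀ i j, C i j = A (σ i) (τ j)) ∧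
      tdet C = ∑ i, C i i ∧ C 0 0 ≤ C 1 0 ∧ C 0 0 ≠ ⊥ := by
  obtain ⟨ρ, hρ⟩ := exists_tdet_eq_sum A
  obtain ⟨hbot, i, hi, hle⟩ := hyp ρ hρ
  obtain ⟨σ, h0, h1⟩ := exists_perm_apply_eq_apply_eq (zero_ne_one (α := Fin (n + 2))) hi.symm
  have hτ : (ρ * σ) 0 = 0 := by simp [h0]
  refine ⟨σ, ρ * σ, A.submatrix σ (ρ * σ : Equiv.Perm _), hτ, fun _ _ => rfl, ?_, ?_, ?_⟩
  · rw [tdet_submatrix, hρ, ← Equiv.sum_comp σ]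
    rfl
  · rwa [Matrix.submatrix_apply, Matrix.submatrix_apply, hτ, h0, h1]
  · rwa [Matrix.submatrix_apply, hτ, h0]
end

section
/- Existence of Ritt's second form (the gap in Ritt's 1935 proof, repaired via Hall's Matching Theorem): Let n ≥ 2 and let A = (a_{i,j}) be an n×n matrix with entries in ℤ ∪ {−∞} with tdet(A) ≠ −∞. Suppose that for every ρ ∈ S_n with tdet(A) = ∑_{i=1}^n a_{i,ρ(i)}, the entry of this maximal transversal lying in the first column, namely a_{ρ⁻¹(1),1}, is ≠ −∞ and is the strict maximum of the first column (a_{ρ⁻¹(1),1} > a_{i,1} for all i ≠ ρ⁻¹(1)); suppose additionally that at least one entry of the first column other than this maximum is ≠ −∞. Then there exist permutations σ, τ ∈ S_n with τ(1) = 1 (the column permutation does not move the first column) such that the matrix C with c_{i,j} = a_{σ(i),τ(j)} is in Ritt's second form: tdet(C) = c_{1,n} + (∑_{i=2}^{n−1} c_{i,i}) + c_{n,1}; tdet(C̃_{n,n}) = ∑_{i=1}^{n−1} c_{i,i} with c_{i,i} ≠ −∞ for 1 ≤ i ≤ n−1; and c_{n,1} = max{c_{1,1},…,c_{n,1}}.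 -/
open Finset in
theorem sum_coe_add_perm {ι : Type*} [Fintype ι] (u v : ι → ℤ) (ρ : Equiv.Perm ι) :
    ∑ i, ((u i + v (ρ i) : ℤ) : WithBot ℤ) = ((∑ i, u i + ∑ i, v i : ℤ) : WithBot ℤ) := by
  rw [← Equiv.sum_comp ρ v, ← sum_add_distrib]
  exact (map_sum (WithBot.addHom (α := ℤ)) _ _).symm

/-- Weak duality: every transversal is bounded by the value of a dual cover. -/
theorem tdet_le_of_cover {ι : Type*} [Fintype ι] [DecidableEq ι]
    {A : Matrix ι ι (WithBot ℤ)} {u v : ι → ℤ}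
    (h : ∀ i j, A i j ≤ ((u i + v j : ℤ) : WithBot ℤ)) :
    tdet A ≤ ((∑ i, u i + ∑ i, v i : ℤ) : WithBot ℤ) :=
  Finset.sup_le fun ρ _ =>
    (Finset.sum_le_sum fun i _ => h i (ρ i)).trans_eq (sum_coe_add_perm u v ρ)

/-- A transversal that is tight for a dual cover is maximal. -/
theorem tdet_eq_of_tight {ι : Type*} [Fintype ι] [DecidableEq ι]
    {A : Matrix ι ι (WithBot ℤ)} {u v : ι → ℤ}
    (h : ∀ i j, A i j ≤ ((u i + v j : ℤ) : WithBot ℤ)) (π : Equiv.Perm ι)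
    (hπ : ∀ i, A i (π i) = ((u i + v (π i) : ℤ) : WithBot ℤ)) :
    tdet A = ∑ i, A i (π i) := by
  apply le_antisymm
  · rw [Finset.sum_congr rfl fun i _ => hπ i, sum_coe_add_perm]
    exact tdet_le_of_cover h
  · exact Finset.le_sup (f := fun ρ : Equiv.Perm ι => ∑ i, A i (ρ i)) (Finset.mem_univ π)

open Finset in
/-- If no transversal is tight for a dual cover, Hall's theorem yields a cheaper cover. -/
theorem exists_tight_or_exists_lt_cover {ι : Type*} [Fintype ι] [DecidableEq ι]
    {A : Matrix ι ι (WithBot ℤ)} {u v : ι → ℤ}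
    (h : ∀ i j, A i j ≤ ((u i + v j : ℤ) : WithBot ℤ)) :
    (∃ π : Equiv.Perm ι, ∀ i, A i (π i) = ((u i + v (π i) : ℤ) : WithBot ℤ)) ∨
    ∃ u' v' : ι → ℤ, (∀ i j, A i j ≤ ((u' i + v' j : ℤ) : WithBot ℤ)) ∧
      ∑ i, u' i + ∑ i, v' i < ∑ i, u i + ∑ i, v i := by
  classical
  let t : ι → Finset ι := fun i => {j | A i j = ((u i + v j : ℤ) : WithBot ℤ)}
  by_cases hall : ∀ s : Finset ι, #s ≤ #(s.biUnion t)
  · left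
    obtain ⟨f, hf, hft⟩ := (all_card_le_biUnion_card_iff_exists_injective t).1 hall
    exact ⟨Equiv.ofBijective f (Finite.injective_iff_bijective.1 hf),
      fun i => (mem_filter.1 (hft i)).2⟩
  · right
    push Not at hall
    obtain ⟨s, hs⟩ := hall
    refine ⟨fun i => u i - if i ∈ s then 1 else 0,
      fun j => v j + if j ∈ s.biUnion t then 1 else 0, fun i j => ?_, ?_⟩
    · have hij := h i j
      by_cases hi : i ∈ s <;> by_cases hj : j ∈ s.biUnion t
      · simpa only [hi, hj, if_true, sub_add_add_cancel] using hij
      · have hne : A i j ≠ ((u i + v j : ℤ) : WithBot ℤ) := fun he =>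
          hj (mem_biUnion.2 ⟨i, hi, mem_filter.2 ⟨mem_univ _, he⟩⟩)
        simp only [hi, hj, if_true, if_false]
        revert hij hne
        cases A i j with
        | bot => exact fun _ _ => bot_le
        | coe a =>
          simp only [ne_eq, WithBot.coe_le_coe, WithBot.coe_inj]
          omega
      · simp only [hi, hj, if_true, if_false]
        exact hij.trans (WithBot.coe_le_coe.2 (by omega))
      · simpa only [hi, hj, if_false, sub_zero, add_zero] using hij
    · rw [sum_sub_distrib, sum_add_distrib]
      simp only [sum_boole, filter_univ_mem]
      omega

/-- Strong duality (Egerváry): a finite tropical determinant admits a dual cover with a tight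
transversal. -/
theorem exists_cover_tight {ι : Type*} [Fintype ι] [DecidableEq ι]
    (A : Matrix ι ι (WithBot ℤ)) (hA : tdet A ≠ ⊥) :
    ∃ (u v : ι → ℤ) (π : Equiv.Perm ι), (∀ i j, A i j ≤ ((u i + v j : ℤ) : WithBot ℤ)) ∧
      ∀ i, A i (π i) = ((u i + v (π i) : ℤ) : WithBot ℤ) := by
  obtain ⟨d, hd⟩ := WithBot.ne_bot_iff_exists.1 hA
  let P : ℤ → Prop := fun z => ∃ u v : ι → ℤ,
    (∀ i j, A i j ≤ ((u i + v j : ℤ) : WithBot ℤ)) ∧ ∑ i, u i + ∑ i, v i = z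
  have hbdd : ∃ b : ℤ, ∀ z : ℤ, P z → b ≤ z := by
    refine ⟨d, ?_⟩
    rintro z ⟨u, v, h, rfl⟩
    exact WithBot.coe_le_coe.1 (hd ▸ tdet_le_of_cover h)
  have hne : ∃ z : ℤ, P z := by
    obtain ⟨M, hM⟩ := (Set.finite_range fun p : ι × ι => (A p.1 p.2).unbotD 0).bddAbove
    refine ⟨_, fun _ => M, fun _ => 0, fun i j => ?_, rfl⟩
    have hle : (A i j).unbotD 0 ≤ M := hM ⟨(i, j), rfl⟩
    rw [add_zero]
    revert hle
    cases A i j with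
    | bot => exact fun _ => bot_le
    | coe a => exact WithBot.coe_le_coe.2
  obtain ⟨z, ⟨u, v, h, rfl⟩, hmin⟩ := Int.exists_least_of_bdd hbdd hne
  rcases exists_tight_or_exists_lt_cover h with ⟨π, hπ⟩ | ⟨u', v', h', hlt⟩
  · exact ⟨u, v, π, h, hπ⟩
  · exact absurd (hmin _ ⟨u', v', h', rfl⟩) hlt.not_ge

/-- **Existence of Ritt's second form** (the repaired gap in Ritt's 1935 proof).
Indices are `0`-based: row/column `0` plays the role of `1` and `Fin.last (n+1)`
plays the role of `n`; the matrix has size `n + 2 ≥ 2`.  Suppose `tdet A ≠ −∞`, and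
for every permutation `ρ` realizing the tropical determinant the entry of the maximal
transversal in the first column, `A (ρ⁻¹ 0) 0`, is finite and is the strict maximum
of the first column, and moreover some other entry of the first column is finite.
Then there are a row permutation `σ` and a column permutation `τ` fixing the first
column such that `C i j = A (σ i) (τ j)` is in Ritt's second form:
`tdet C = c_{1,n} + (∑_{i=2}^{n-1} c_{i,i}) + c_{n,1}`, the tropical determinant of the
submatrix `C̃_{n,n}` (delete last row and column) equals `∑_{i=1}^{n-1} c_{i,i}` with
these diagonal entries finite, and `c_{n,1}` is the maximum of the first column. -/
theorem exists_ritt_second_form (n : ℕ)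
    (A : Matrix (Fin (n + 2)) (Fin (n + 2)) (WithBot ℤ))
    (htop : tdet A ≠ ⊥)
    (hyp : ∀ ρ : Equiv.Perm (Fin (n + 2)), tdet A = ∑ i, A i (ρ i) →
      A (ρ⁻¹ 0) 0 ≠ ⊥ ∧ (∀ i, i ≠ ρ⁻¹ 0 → A i 0 < A (ρ⁻¹ 0) 0) ∧
      ∃ i, i ≠ ρ⁻¹ 0 ∧ A i 0 ≠ ⊥) :
    ∃ (σ τ : Equiv.Perm (Fin (n + 2)))
      (C : Matrix (Fin (n + 2)) (Fin (n + 2)) (WithBot ℤ)),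
      τ 0 = 0 ∧ (∀ i j, C i j = A (σ i) (τ j)) ∧
      tdet C = C 0 (Fin.last (n + 1)) +
        (∑ i ∈ (Finset.univ.erase (0 : Fin (n + 2))).erase (Fin.last (n + 1)), C i i) +
        C (Fin.last (n + 1)) 0 ∧
      tdet (Matrix.of fun i j : Fin (n + 1) => C i.castSucc j.castSucc) =
        ∑ i : Fin (n + 1), C i.castSucc i.castSucc ∧
      (∀ i : Fin (n + 1), C i.castSucc i.castSucc ≠ ⊥) ∧
      ∀ i, C i 0 ≤ C (Fin.last (n + 1)) 0 := by
  classical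
  obtain ⟨u, v, ρ, hcov, htight⟩ := exists_cover_tight A htop
  obtain ⟨-, hmax, r₁, hr₁, hr₁A⟩ := hyp ρ (tdet_eq_of_tight hcov ρ htight)
  set m := ρ⁻¹ 0 with hm
  let R : Finset (Fin (n + 2)) := {r | r ≠ m ∧ A r 0 ≠ ⊥}
  obtain ⟨r₀, hr₀, hr₀max⟩ := R.exists_max_image (fun r => (A r 0).unbotD 0 - u r)
    ⟨r₁, by simp [R, hr₁, hr₁A]⟩
  obtain ⟨hr₀m, hr₀A⟩ : r₀ ≠ m ∧ A r₀ 0 ≠ ⊥ := by simpa [R] using hr₀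
  obtain ⟨a, ha⟩ := WithBot.ne_bot_iff_exists.1 hr₀A
  have hcol : ∀ r, r ≠ m → A r 0 ≤ ((u r + (a - u r₀) : ℤ) : WithBot ℤ) := by
    intro r hr
    by_cases hb : A r 0 = ⊥
    · simp [hb]
    · have hle := hr₀max r (by simp [R, hr, hb])
      obtain ⟨b, hb⟩ := WithBot.ne_bot_iff_exists.1 hb
      rw [← ha, ← hb] at hle
      rw [← hb, WithBot.coe_le_coe]
      simp only [WithBot.unbotD_coe] at hle
      omega
  have hlast : Fin.last (n + 1) ≠ 0 := Fin.last_pos.ne'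
  have hq : ρ r₀ ≠ 0 := fun h => hr₀m (by simp [hm, ← h])
  let τ := Equiv.swap (Fin.last (n + 1)) (ρ r₀)
  let s := Equiv.swap (0 : Fin (n + 2)) (Fin.last (n + 1))
  let σ := ρ⁻¹ * τ * s
  have hτ0 : τ 0 = 0 := Equiv.swap_apply_of_ne_of_ne hlast.symm hq.symm
  have hσ : ∀ i, ρ (σ i) = τ (s i) := fun i => by simp [σ]
  have hσ0 : σ 0 = r₀ := by simp [σ, s, τ]
  have hσlast : σ (Fin.last (n + 1)) = m := by simp [σ, s, hτ0, hm]
  have hs : ∀ i, i ≠ 0 → i ≠ Fin.last (n + 1) → s i = i := fun i h h' =>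
    Equiv.swap_apply_of_ne_of_ne h h'
  let C : Matrix (Fin (n + 2)) (Fin (n + 2)) (WithBot ℤ) := Matrix.of fun i j => A (σ i) (τ j)
  let w : Fin (n + 1) → ℤ := fun j => if j = 0 then a - u r₀ else v (τ j.castSucc)
  have hdiag : ∀ i : Fin (n + 1),
      C i.castSucc i.castSucc = ((u (σ i.castSucc) + w i : ℤ) : WithBot ℤ) := by
    intro i
    by_cases hi : i = 0
    · subst hi
      simp [C, w, hτ0, hσ0, ← ha]
    · have h := htight (σ i.castSucc)
      rw [hσ, hs _ (by simpa using hi) (Fin.castSucc_lt_last i).ne] at h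
      simpa [C, w, hi] using h
  refine ⟨σ, τ, C, hτ0, fun _ _ => rfl, ?_, ?_, fun i => ?_, fun i => ?_⟩
  · rw [tdet_eq_of_tight (A := C) (u := u ∘ σ) (v := v ∘ τ) (fun i j => hcov _ _) s
      (fun i => by simpa [C, hσ] using htight (σ i)),
      ← Finset.add_sum_erase _ _ (Finset.mem_univ (0 : Fin (n + 2))),
      ← Finset.sum_erase_add _ _ (Finset.mem_erase.2 ⟨hlast, Finset.mem_univ _⟩), ← add_assoc]
    rw [Equiv.swap_apply_left, Equiv.swap_apply_right]
    congr 2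
    refine Finset.sum_congr rfl fun i hi => ?_
    simp only [Finset.mem_erase, Finset.mem_univ, and_true] at hi
    rw [hs i hi.2 hi.1]
  · refine tdet_eq_of_tight (u := fun i : Fin (n + 1) => u (σ i.castSucc)) (v := w) (fun i j => ?_)
      (Equiv.refl _) hdiag
    by_cases hj : j = 0
    · subst hj
      have hne : σ i.castSucc ≠ m := by
        rw [← hσlast]
        exact σ.injective.ne (Fin.castSucc_lt_last i).ne
      simpa [C, w, hτ0] using hcol _ hne
    · simpa [C, w, hj] using hcov (σ i.castSucc) (τ j.castSucc)
  · rw [hdiag]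
    exact WithBot.coe_ne_bot
  · simp only [C, Matrix.of_apply, hτ0, hσlast]
    rcases eq_or_ne (σ i) m with h | h
    · rw [h]
    · exact (hmax _ h).le
end

section
/- (Decomposition of a k-regular bipartite multigraph into k perfect matchings, used in the proof of the existence of Ritt's second form.) Let m ≥ 1 and k ≥ 1 be integers and let c : {1,…,m} × {1,…,m} → ℕ satisfy ∑_{j=1}^m c(i,j) = k for every i and ∑_{i=1}^m c(i,j) = k for every j (c is the multiplicity matrix of a k-regular bipartite multigraph). Then there exist permutations π₁, …, π_k ∈ S_m such that for all i and j, c(i,j) equals the number of indices l ∈ {1,…,k} with π_l(i) = j; in particular ∑_{i,j} c(i,j)·a_{i,j} = ∑_{l=1}^k ∑_{i=1}^m a_{i,π_l(i)} for any matrix (a_{i,j}) with entries in a commutative additive monoid. -/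
/-- Hall's condition holds for a positive regular bipartite multigraph, so its support contains a
perfect matching. -/
theorem exists_perm_forall_pos_of_regular {ι : Type*} [Fintype ι] [DecidableEq ι] {k : ℕ}
    (hk : 0 < k) (c : ι → ι → ℕ)
    (hrow : ∀ i, ∑ j, c i j = k) (hcol : ∀ j, ∑ i, c i j = k) :
    ∃ σ : Equiv.Perm ι, ∀ i, 0 < c i (σ i) := by
  let t : ι → Finset ι := fun i => Finset.univ.filter fun j => 0 < c i j
  have hall : ∀ s : Finset ι, s.card ≤ (s.biUnion t).card := by
    intro s
    have hsupp : ∀ i ∈ s, ∑ j ∈ s.biUnion t, c i j = k := by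
      intro i hi
      rw [← hrow i]
      refine Finset.sum_subset (Finset.subset_univ _) fun j _ hj => ?_
      by_contra h
      exact hj (Finset.mem_biUnion.2
        ⟨i, hi, Finset.mem_filter.2 ⟨Finset.mem_univ _, Nat.pos_of_ne_zero h⟩⟩)
    refine Nat.le_of_mul_le_mul_right ?_ hk
    calc s.card * k = ∑ i ∈ s, ∑ j ∈ s.biUnion t, c i j := by
          rw [Finset.sum_congr rfl hsupp, Finset.sum_const, smul_eq_mul]
      _ = ∑ j ∈ s.biUnion t, ∑ i ∈ s, c i j := Finset.sum_comm
      _ ≤ ∑ j ∈ s.biUnion t, k := by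
          refine Finset.sum_le_sum fun j _ => ?_
          rw [← hcol j]
          exact Finset.sum_le_sum_of_subset (Finset.subset_univ s)
      _ = (s.biUnion t).card * k := by rw [Finset.sum_const, smul_eq_mul]
  obtain ⟨f, hf, hft⟩ := (Finset.all_card_le_biUnion_card_iff_exists_injective t).1 hall
  exact ⟨Equiv.ofBijective f (Finite.injective_iff_bijective.1 hf),
    fun i => (Finset.mem_filter.1 (hft i)).2⟩

/-- A matrix of natural numbers with all row and column sums `k` is a sum of `k` permutation
matrices. -/
theorem exists_perms_sum_of_regular {ι : Type*} [Fintype ι] [DecidableEq ι] (k : ℕ)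
    (c : ι → ι → ℕ) (hrow : ∀ i, ∑ j, c i j = k) (hcol : ∀ j, ∑ i, c i j = k) :
    ∃ π : Fin k → Equiv.Perm ι, ∀ i j, c i j = ∑ l, if π l i = j then 1 else 0 := by
  induction k generalizing c with
  | zero =>
    refine ⟨Fin.elim0, fun i j => ?_⟩
    simpa using Finset.sum_eq_zero_iff.1 (hrow i) j (Finset.mem_univ j)
  | succ k ih =>
    obtain ⟨σ, hσ⟩ := exists_perm_forall_pos_of_regular k.succ_pos c hrow hcol
    have hle : ∀ i j, (if σ i = j then 1 else 0) ≤ c i j := by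
      intro i j
      split_ifs with h
      · exact h ▸ hσ i
      · exact Nat.zero_le _
    obtain ⟨π, hπ⟩ := ih (fun i j => c i j - if σ i = j then 1 else 0)
      (fun i => by
        rw [Finset.sum_tsub_distrib _ fun j _ => hle i j, hrow]
        simp)
      (fun j => by
        rw [Finset.sum_tsub_distrib _ fun i _ => hle i j, hcol]
        simp [← Equiv.eq_symm_apply])
    refine ⟨Fin.cons σ π, fun i j => ?_⟩
    rw [Fin.sum_univ_succ]
    simp only [Fin.cons_zero, Fin.cons_succ]
    rw [← hπ i j, Nat.add_sub_cancel' (hle i j)]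


/-- **Decomposition of a `k`-regular bipartite multigraph into `k` perfect matchings.**
If `c : Fin m × Fin m → ℕ` has all row sums and all column sums equal to `k ≥ 1`
(the multiplicity matrix of a `k`-regular bipartite multigraph on parts of size
`m ≥ 1`), then there are permutations `π₁, …, π_k` of `Fin m` such that `c i j` is the
number of `l` with `π l i = j`; consequently, for any matrix `a` with entries in a
commutative additive monoid, `∑ i j, c i j • a i j = ∑ l, ∑ i, a i (π l i)`. -/
theorem regular_bipartite_decomposes_into_matchings (m k : ℕ) (hm : 1 ≤ m) (hk : 1 ≤ k)
    (c : Fin m → Fin m → ℕ)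
    (hrow : ∀ i, ∑ j, c i j = k) (hcol : ∀ j, ∑ i, c i j = k) :
    ∃ π : Fin k → Equiv.Perm (Fin m),
      (∀ i j, c i j = (Finset.univ.filter fun l => π l i = j).card) ∧
      ∀ (M : Type) [AddCommMonoid M] (a : Fin m → Fin m → M),
        ∑ i, ∑ j, c i j • a i j = ∑ l, ∑ i, a i (π l i) := by
  obtain ⟨π, hπ⟩ := exists_perms_sum_of_regular k c hrow hcol
  refine ⟨π, fun i j => by rw [hπ, Finset.card_filter], fun M _ a => ?_⟩
  rw [Finset.sum_comm (s := (Finset.univ : Finset (Fin k)))]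
  refine Finset.sum_congr rfl fun i _ => ?_
  simp only [hπ, Finset.sum_smul]
  rw [Finset.sum_comm]
  simp [ite_smul]
end

section
/- (Minimal primes are preserved under Ritt division with nonvanishing separant.) Let R be a commutative ring equipped with a derivation ∂ : R → R (∂ is additive and satisfies the Leibniz rule ∂(ab) = a∂(b) + ∂(a)b). For a subset S ⊆ R let [S] denote the smallest differential ideal of R containing S, i.e. the smallest ideal containing S and closed under ∂. Let n ≥ 2, let u₁, …, u_n ∈ R, and let s, h ∈ R be such that s·u₂ − h ∈ [{u₁}]. Let P be a prime ideal of R containing [{u₁,…,u_n}] that is minimal among prime ideals containing [{u₁,…,u_n}], and assume s ∉ P. Then [{u₁, h, u₃, …, u_n}] ⊆ P and P is minimal among prime ideals containing [{u₁, h, u₃, …, u_n}]. -/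
/-- The smallest differential ideal `[S]` containing a subset `S` of a commutative ring
equipped with a map `D` (the derivation `∂`): the infimum of all ideals containing `S`
and stable under `D`. -/
def diffIdealClosure {R : Type*} [CommRing R] (D : R → R) (S : Set R) : Ideal R :=
  sInf {I : Ideal R | S ⊆ I ∧ ∀ x ∈ I, D x ∈ I}

section DiffIdealClosure

variable {R : Type*} [CommRing R] {D : R → R}

theorem subset_diffIdealClosure (S : Set R) : S ⊆ diffIdealClosure D S := fun _ hx =>
  Submodule.mem_sInf.2 fun _ hI => hI.1 hx

theorem map_mem_diffIdealClosure {S : Set R} {x : R} (hx : x ∈ diffIdealClosure D S) :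
    D x ∈ diffIdealClosure D S :=
  Submodule.mem_sInf.2 fun I hI => hI.2 x (Submodule.mem_sInf.1 hx I hI)

theorem diffIdealClosure_le {S : Set R} {I : Ideal R} (hS : S ⊆ I) (hD : ∀ x ∈ I, D x ∈ I) :
    diffIdealClosure D S ≤ I :=
  sInf_le ⟨hS, hD⟩

theorem diffIdealClosure_le_diffIdealClosure {S T : Set R}
    (h : S ⊆ diffIdealClosure D T) : diffIdealClosure D S ≤ diffIdealClosure D T :=
  diffIdealClosure_le h fun _ => map_mem_diffIdealClosure

/-- The saturation `J : s^∞` of an ideal `J` by the powers of an element `s`. -/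
def idealSaturation (J : Ideal R) (s : R) : Ideal R where
  carrier := {x | ∃ k : ℕ, s ^ k * x ∈ J}
  zero_mem' := ⟨0, by simp⟩
  add_mem' := by
    rintro x y ⟨k, hk⟩ ⟨l, hl⟩
    refine ⟨k + l, ?_⟩
    have : s ^ (k + l) * (x + y) = s ^ l * (s ^ k * x) + s ^ k * (s ^ l * y) := by ring
    rw [this]
    exact J.add_mem (J.mul_mem_left _ hk) (J.mul_mem_left _ hl)
  smul_mem' := by
    rintro c x ⟨k, hk⟩
    refine ⟨k, ?_⟩
    rw [smul_eq_mul, mul_left_comm]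
    exact J.mul_mem_left c hk

theorem mem_idealSaturation {J : Ideal R} {s x : R} :
    x ∈ idealSaturation J s ↔ ∃ k : ℕ, s ^ k * x ∈ J :=
  Iff.rfl

theorem le_idealSaturation (J : Ideal R) (s : R) : J ≤ idealSaturation J s := fun x hx =>
  ⟨0, by simpa using hx⟩

theorem idealSaturation_le_of_isPrime {J Q : Ideal R} {s : R} (hQ : Q.IsPrime) (hJ : J ≤ Q)
    (hs : s ∉ Q) : idealSaturation J s ≤ Q := by
  rintro x ⟨k, hk⟩
  exact (hQ.mem_or_mem (hJ hk)).resolve_left fun hsk => hs (hQ.mem_of_pow_mem k hsk)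

theorem map_mem_idealSaturation (hleib : ∀ a b, D (a * b) = a * D b + D a * b)
    {J : Ideal R} (hJ : ∀ x ∈ J, D x ∈ J) {s x : R} (hx : x ∈ idealSaturation J s) :
    D x ∈ idealSaturation J s := by
  obtain ⟨k, hk⟩ := hx
  refine ⟨k + k, ?_⟩
  have : s ^ (k + k) * D x = s ^ k * D (s ^ k * x) - D (s ^ k) * (s ^ k * x) := by
    rw [hleib]
    ring
  rw [this]
  exact J.sub_mem (J.mul_mem_left _ (hJ _ hk)) (J.mul_mem_left _ hk)

end DiffIdealClosure

/-- **Minimal primes are preserved under Ritt division with nonvanishing separant.**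
Indices are `0`-based: `u 0` and `u 1` play the roles of `u₁` and `u₂`, and the system
has `n + 2 ≥ 2` equations.  Let `D` be a derivation on a commutative ring `R`, let
`s·u₂ − h ∈ [{u₁}]` (so `h` is a Ritt remainder of `u₂` after ∂-division by `u₁`),
and let `P` be a minimal prime over `[{u₁,…,u_n}]` with `s ∉ P`.  Then the differential
ideal of the new system `{u₁, h, u₃, …, u_n}` (i.e. `u₂` replaced by `h`) is contained
in `P`, and `P` is a minimal prime over it. -/
theorem minimal_prime_preserved_under_ritt_division
    {R : Type*} [CommRing R] (D : R → R)
    (hadd : ∀ a b, D (a + b) = D a + D b)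
    (hleib : ∀ a b, D (a * b) = a * D b + D a * b)
    (n : ℕ) (u : Fin (n + 2) → R) (s h : R)
    (hsh : s * u 1 - h ∈ diffIdealClosure D {u 0})
    (P : Ideal R)
    (hP : P ∈ (diffIdealClosure D (Set.range u)).minimalPrimes)
    (hs : s ∉ P) :
    diffIdealClosure D (Set.range (Function.update u 1 h)) ≤ P ∧
      P ∈ (diffIdealClosure D (Set.range (Function.update u 1 h))).minimalPrimes := by
  have h01 : (0 : Fin (n + 2)) ≠ 1 := by simp
  have hle : diffIdealClosure D (Set.range (Function.update u 1 h)) ≤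
      diffIdealClosure D (Set.range u) := by
    apply diffIdealClosure_le_diffIdealClosure
    rintro _ ⟨i, rfl⟩
    have hu (j) : u j ∈ diffIdealClosure D (Set.range u) := subset_diffIdealClosure _ ⟨j, rfl⟩
    rcases eq_or_ne i 1 with rfl | hi
    · have hsub : s * u 1 - h ∈ diffIdealClosure D (Set.range u) :=
        diffIdealClosure_le_diffIdealClosure (Set.singleton_subset_iff.2 (hu 0)) hsh
      simpa using Ideal.sub_mem _ (Ideal.mul_mem_left _ s (hu 1)) hsub
    · simpa [hi] using hu i
  have hsat : diffIdealClosure D (Set.range u) ≤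
      idealSaturation (diffIdealClosure D (Set.range (Function.update u 1 h))) s := by
    refine diffIdealClosure_le ?_ fun _ =>
      map_mem_idealSaturation hleib fun _ => map_mem_diffIdealClosure
    rintro _ ⟨i, rfl⟩
    have hv (j) : Function.update u 1 h j ∈
        diffIdealClosure D (Set.range (Function.update u 1 h)) :=
      subset_diffIdealClosure _ ⟨j, rfl⟩
    rcases eq_or_ne i 1 with rfl | hi
    · have hsub : s * u 1 - h ∈ diffIdealClosure D (Set.range (Function.update u 1 h)) :=
        diffIdealClosure_le_diffIdealClosure
          (Set.singleton_subset_iff.2 (by simpa [h01] using hv 0)) hsh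
      refine mem_idealSaturation.2 ⟨1, ?_⟩
      rw [pow_one, ← sub_add_cancel (s * u 1) h]
      exact Ideal.add_mem _ hsub (by simpa using hv 1)
    · exact le_idealSaturation _ s (by simpa [hi] using hv i)
  have hJP := hle.trans hP.1.2
  refine ⟨hJP, ⟨hP.1.1, hJP⟩, fun Q hQ hQP => hP.2 ⟨hQ.1, ?_⟩ hQP⟩
  exact hsat.trans (idealSaturation_le_of_isPrime hQ.1 hQ.2 fun hsQ => hs (hQP hsQ))
end

section
/- (Finite dimensionality of components in one differential variable.) Let K be a field of characteristic zero equipped with a derivation δ : K → K, and let R = MvPolynomial ℕ K be the polynomial ring in countably many variables X₀, X₁, X₂, …, equipped with a derivation ∂ : R → R that extends δ on constants and satisfies ∂(X_r) = X_{r+1} for all r (so R is the differential polynomial ring K{x} with X_r playing the role of x^{(r)}). For S ⊆ R let [S] denote the smallest ∂-stable ideal of R containing S. Let T ⊆ R ∖ {0} be a finite nonempty set, and let P be a prime ideal of R that is minimal among prime ideals containing [T]. Then the fraction field of R/P has finite transcendence degree over K. -/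
open MvPolynomial in
/-- In characteristic zero, every nonzero proper ideal contains a polynomial whose partial
derivative with respect to some variable, bounding all its variables, is outside the ideal. -/
theorem exists_mem_pderiv_notMem {K : Type*} [Field K] [CharZero K]
    (P : Ideal (MvPolynomial ℕ K)) (hP : P ≠ ⊤) (hP0 : ∃ f ∈ P, f ≠ 0) :
    ∃ f ∈ P, ∃ n, f ∈ supported K (Set.Iic n) ∧ pderiv n f ∉ P := by
  obtain ⟨f, ⟨hfP, hf0⟩, hmin⟩ := exists_minimalFor_of_wellFoundedLT
    (fun f : MvPolynomial ℕ K => f ∈ P ∧ f ≠ 0) totalDegree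
    (by obtain ⟨f, h1, h2⟩ := hP0; exact ⟨f, h1, h2⟩)
  have hv : f.vars.Nonempty := by
    rw [Finset.nonempty_iff_ne_empty]
    intro h
    obtain ⟨c, rfl⟩ : ∃ c, C c = f := by
      have := (mem_supported (s := (∅ : Set ℕ))).2 (by simp [h] : ((f.vars : Set ℕ) ⊆ ∅))
      rwa [supported_empty, Algebra.mem_bot] at this
    have hc : c ≠ 0 := by rintro rfl; simp at hf0
    exact hP (Ideal.eq_top_of_isUnit_mem _ hfP ((isUnit_iff_ne_zero.2 hc).map C))
  refine ⟨f, hfP, f.vars.max' hv, mem_supported.2 fun i hi => f.vars.le_max' i hi, fun hmem => ?_⟩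
  set n := f.vars.max' hv
  obtain ⟨m, hm, hnm⟩ := (mem_vars_iff_mem_support _).1 (f.vars.max'_mem hv)
  have hmn : m n ≠ 0 := Finsupp.mem_support_iff.1 hnm
  have hne : pderiv n f ≠ 0 := by
    intro h
    have := congrArg (coeff (m - Finsupp.single n 1)) h
    rw [coeff_pderiv, tsub_add_cancel_of_le
      (by simpa [Nat.one_le_iff_ne_zero] using hmn), coeff_zero] at this
    rcases mul_eq_zero.1 this with h | h
    · exact mem_support_iff.1 hm h
    · exact Nat.cast_add_one_ne_zero _ h
  have hlt : (pderiv n f).totalDegree < f.totalDegree := by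
    rw [totalDegree, Finset.sup_lt_iff]
    · intro k hk
      rw [mem_support_iff, coeff_pderiv] at hk
      have := le_totalDegree (mem_support_iff.2 (left_ne_zero_of_mul hk))
      rw [Finsupp.sum_add_index' (by simp) (by simp), Finsupp.sum_single_index rfl] at this
      exact this
    · refine lt_of_lt_of_le ?_ (le_totalDegree hm)
      exact lt_of_lt_of_le (Nat.pos_of_ne_zero hmn)
        (Finset.single_le_sum (f := fun i => m i) (fun _ _ => Nat.zero_le _) hnm)
  exact absurd (hmin ⟨hmem, hne⟩ hlt.le) (not_le.2 hlt)

/-- A minimal prime over a differential ideal of a `ℚ`-algebra is a differential ideal. -/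
theorem Derivation.apply_mem_of_mem_minimalPrimes {R : Type*} [CommRing R] [Algebra ℚ R]
    (D : Derivation ℤ R R) {I P : Ideal R} (hI : ∀ x ∈ I, D x ∈ I) (hP : P ∈ I.minimalPrimes)
    {a : R} (ha : a ∈ P) : D a ∈ P := by
  have hprime : P.IsPrime := hP.1.1
  obtain ⟨s, hs, n, hn⟩ : ∃ s ∉ P, ∃ n : ℕ, s * a ^ n ∈ I := by
    by_contra! h
    obtain ⟨Q, hQ, hIQ, hdisj⟩ := Ideal.exists_le_prime_disjoint I
      (P.primeCompl ⊔ Submonoid.powers a) (Set.disjoint_left.2 fun x hxI hx => by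
        obtain ⟨s, hs, _, ⟨n, rfl⟩, rfl⟩ := Submonoid.mem_sup.1 hx
        exact h s hs n hxI)
    have hQP : Q ≤ P := fun x hx => by
      by_contra hxP
      exact Set.disjoint_left.1 hdisj hx
        ((le_sup_left : P.primeCompl ≤ P.primeCompl ⊔ Submonoid.powers a) hxP)
    exact Set.disjoint_left.1 hdisj (hP.2 ⟨hQ, hIQ⟩ hQP ha)
      ((le_sup_right : _ ≤ P.primeCompl ⊔ Submonoid.powers a) (Submonoid.mem_powers a))
  have key : ∀ k m : ℕ, ∀ s ∉ P, s * a ^ k * D a ^ m ∈ I → D a ∈ P := by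
    intro k
    induction k with
    | zero =>
      intro m s hs h
      have := hP.1.2 h
      rw [pow_zero, mul_one] at this
      exact hprime.mem_of_pow_mem _ ((hprime.mem_or_mem this).resolve_left hs)
    | succ k ih =>
      intro m s hs h
      refine ih (m + 2) (s * s) (fun h => (hprime.mem_or_mem h).elim hs hs) ?_
      have h1 := I.mul_mem_left (s * D a) (hI _ h)
      have h2 : (k + 1 : R) * (s * s * a ^ k * D a ^ (m + 2)) ∈ I := by
        have h3 : (k + 1 : R) * (s * s * a ^ k * D a ^ (m + 2)) =
            s * D a * D (s * a ^ (k + 1) * D a ^ m)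
            - (D s * D a + m * s * D (D a)) * (s * a ^ (k + 1) * D a ^ m) := by
          rcases m with _ | m <;>
          simp [Derivation.leibniz, Derivation.leibniz_pow] <;> ring
        rw [h3]
        exact I.sub_mem h1 (I.mul_mem_left _ h)
      have h4 := I.mul_mem_left (algebraMap ℚ R (k + 1 : ℚ)⁻¹) h2
      have h5 : algebraMap ℚ R (k + 1 : ℚ)⁻¹ * (k + 1 : R) = 1 := by
        rw [show (k + 1 : R) = algebraMap ℚ R (k + 1) by simp, ← map_mul,
          inv_mul_cancel₀ (by positivity), map_one]
      rwa [← mul_assoc, h5, one_mul] at h4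
  exact key n 0 s hs (by simpa using hn)

theorem MvPolynomial.pderiv_mem_supported {σ R : Type*} [CommSemiring R] {s : Set σ} (i : σ)
    {f : MvPolynomial σ R} (hf : f ∈ supported R s) : pderiv i f ∈ supported R s := by
  classical
  induction hf using Algebra.adjoin_induction with
  | mem x hx =>
    obtain ⟨j, -, rfl⟩ := hx
    rw [pderiv_X, Pi.single_apply]
    split_ifs
    exacts [one_mem _, zero_mem _]
  | algebraMap a =>
    rw [algebraMap_eq, pderiv_C]
    exact zero_mem _
  | add x y _ _ hx hy =>
    rw [map_add]
    exact add_mem hx hy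
  | mul x y hx' hy' hx hy =>
    rw [pderiv_mul]
    exact add_mem (mul_mem hx hy') (mul_mem hx' hy)

open MvPolynomial in
/-- If `f` involves only `X 0, …, X n`, then `D f` is congruent to `∂f/∂X n * X (n + 1)`
modulo polynomials in `X 0, …, X n`. -/
theorem Derivation.sub_pderiv_mul_X_mem_supported {K : Type*} [Field K]
    (D : Derivation ℤ (MvPolynomial ℕ K) (MvPolynomial ℕ K))
    (hC : ∀ a : K, ∃ b, D (C a) = C b) (hX : ∀ r : ℕ, D (X r) = X (r + 1))
    {n : ℕ} {f : MvPolynomial ℕ K} (hf : f ∈ supported K (Set.Iic n)) :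
    D f - pderiv n f * X (n + 1) ∈ supported K (Set.Iic n) := by
  induction hf using Algebra.adjoin_induction with
  | mem x hx =>
    obtain ⟨i, hi, rfl⟩ := hx
    rcases (Set.mem_Iic.1 hi).eq_or_lt with rfl | h
    · simp [hX, zero_mem]
    · rw [hX, pderiv_X_of_ne h.ne, zero_mul, sub_zero]
      exact X_mem_supported.2 h
  | algebraMap a =>
    obtain ⟨b, hb⟩ := hC a
    rw [algebraMap_eq, hb, pderiv_C, zero_mul, sub_zero, ← algebraMap_eq]
    exact Subalgebra.algebraMap_mem _ _
  | add x y _ _ hx hy =>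
    convert add_mem hx hy using 1
    rw [map_add, map_add]
    ring
  | mul x y hx' hy' hx hy =>
    convert add_mem (mul_mem hx' hy) (mul_mem hy' hx) using 1
    · rfl
    · rw [D.leibniz, Derivation.leibniz]
      simp only [smul_eq_mul]
      ring

open MvPolynomial in
/-- A derivation extending one of `K` with `X r ↦ X (r + 1)` raises the order by at most one. -/
theorem Derivation.apply_mem_supported {K : Type*} [Field K]
    (D : Derivation ℤ (MvPolynomial ℕ K) (MvPolynomial ℕ K))
    (hC : ∀ a : K, ∃ b, D (C a) = C b) (hX : ∀ r : ℕ, D (X r) = X (r + 1))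
    {n : ℕ} {f : MvPolynomial ℕ K} (hf : f ∈ supported K (Set.Iic n)) :
    D f ∈ supported K (Set.Iic (n + 1)) := by
  have hp := D.sub_pderiv_mul_X_mem_supported hC hX
    (supported_mono (Set.Iic_subset_Iic.2 n.le_succ) hf)
  rwa [pderiv_eq_zero_of_notMem_vars, zero_mul, sub_zero] at hp
  intro hmem
  exact absurd (mem_supported.1 hf hmem) (by simp)

open MvPolynomial in
/-- The derivatives of an element of a differential ideal are linear in their leading
variable, with the separant as leading coefficient. -/
theorem Derivation.exists_pderiv_mul_X_add_mem {K : Type*} [Field K]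
    (D : Derivation ℤ (MvPolynomial ℕ K) (MvPolynomial ℕ K))
    (hC : ∀ a : K, ∃ b, D (C a) = C b) (hX : ∀ r : ℕ, D (X r) = X (r + 1))
    {P : Ideal (MvPolynomial ℕ K)} (hP : ∀ x ∈ P, D x ∈ P)
    {n : ℕ} {f : MvPolynomial ℕ K} (hf : f ∈ supported K (Set.Iic n)) (hfP : f ∈ P) (k : ℕ) :
    ∃ g ∈ supported K (Set.Iic (n + k)), pderiv n f * X (n + k + 1) + g ∈ P := by
  have hs := pderiv_mem_supported n hf
  induction k with
  | zero =>
    refine ⟨_, D.sub_pderiv_mul_X_mem_supported hC hX hf, ?_⟩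
    simpa using hP f hfP
  | succ k ih =>
    obtain ⟨g, hg, hgP⟩ := ih
    refine ⟨D (pderiv n f) * X (n + k + 1) + D g, add_mem (mul_mem ?_ ?_) ?_, ?_⟩
    · exact supported_mono (Set.Iic_subset_Iic.2 (by omega)) (D.apply_mem_supported hC hX hs)
    · exact X_mem_supported.2 (Set.mem_Iic.2 (by omega))
    · exact D.apply_mem_supported hC hX hg
    · convert hP _ hgP using 1
      rw [map_add, D.leibniz, hX]
      simp only [smul_eq_mul, ← add_assoc]
      ring

/-- The transcendence degree of a field extension is at most the cardinality of any set
generating it. -/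
theorem trdeg_le_of_adjoin_eq_top {K L : Type*} [Field K] [Field L] [Algebra K L]
    (s : Set L) (hs : IntermediateField.adjoin K s = ⊤) :
    Algebra.trdeg K L ≤ Cardinal.mk s := by
  have : Algebra.IsAlgebraic (Algebra.adjoin K s) L := by
    refine ⟨fun x => ?_⟩
    obtain ⟨a, ha, b, hb, rfl⟩ := IntermediateField.mem_adjoin_iff_div.1
      (hs ▸ IntermediateField.mem_top : x ∈ IntermediateField.adjoin K s)
    rw [div_eq_mul_inv]
    exact (isAlgebraic_algebraMap (⟨a, ha⟩ : Algebra.adjoin K s)).mul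
      (isAlgebraic_algebraMap (⟨b, hb⟩ : Algebra.adjoin K s)).inv
  exact Algebra.IsAlgebraic.trdeg_le_cardinalMk K s

/-- **Finite dimensionality of components in one differential variable.**
Let `K` be a field of characteristic zero with a derivation `δ`, and let
`R = MvPolynomial ℕ K` be the differential polynomial ring `K{x}`, where `X r` plays
the role of `x^{(r)}`, equipped with a derivation `D` extending `δ` and sending
`X r ↦ X (r+1)`.  If `T` is a finite nonempty set of nonzero elements of `R` and `P`
is a minimal prime over the differential ideal `[T]`, then the fraction field of
`R ⧸ P` has finite transcendence degree over `K`: the cardinalities of finite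
algebraically independent subsets are bounded. -/
theorem one_variable_components_finite_dimensional
    (K : Type*) [Field K] [CharZero K] (δ : K → K)
    (hδadd : ∀ a b, δ (a + b) = δ a + δ b)
    (hδleib : ∀ a b, δ (a * b) = a * δ b + δ a * b)
    (D : MvPolynomial ℕ K → MvPolynomial ℕ K)
    (hadd : ∀ p q, D (p + q) = D p + D q)
    (hleib : ∀ p q, D (p * q) = p * D q + D p * q)
    (hC : ∀ a : K, D (MvPolynomial.C a) = MvPolynomial.C (δ a))
    (hX : ∀ r : ℕ, D (MvPolynomial.X r) = MvPolynomial.X (r + 1))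
    (T : Finset (MvPolynomial ℕ K)) (hT0 : (0 : MvPolynomial ℕ K) ∉ T)
    (hTne : T.Nonempty)
    (P : Ideal (MvPolynomial ℕ K))
    (hP : P ∈ (diffIdealClosure D (T : Set (MvPolynomial ℕ K))).minimalPrimes) :
    ∃ d : ℕ, ∀ s : Finset (FractionRing (MvPolynomial ℕ K ⧸ P)),
      AlgebraicIndependent K ((↑) : s → FractionRing (MvPolynomial ℕ K ⧸ P)) →
      s.card ≤ d := by
  let D' : Derivation ℤ (MvPolynomial ℕ K) (MvPolynomial ℕ K) :=
    Derivation.mk' (AddMonoidHom.mk' D hadd).toIntLinearMap fun a b => by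
      simp [hleib, mul_comm]
  have hC' : ∀ a : K, ∃ b, D' (MvPolynomial.C a) = MvPolynomial.C b := fun a => ⟨_, hC a⟩
  have hprime : P.IsPrime := hP.1.1
  have hPD : ∀ x ∈ P, D' x ∈ P := fun x hx =>
    D'.apply_mem_of_mem_minimalPrimes (fun x hx => by
      rw [diffIdealClosure, Submodule.mem_sInf] at hx ⊢
      exact fun J hJ => hJ.2 x (hx J hJ)) hP hx
  obtain ⟨f₀, hf₀⟩ := hTne
  have hf₀P : f₀ ∈ P := hP.1.2 (by
    rw [diffIdealClosure, Submodule.mem_sInf]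
    exact fun J hJ => hJ.1 hf₀)
  obtain ⟨f, hfP, n, hf, hsep⟩ := exists_mem_pderiv_notMem P hprime.ne_top
    ⟨f₀, hf₀P, fun h => hT0 (h ▸ hf₀)⟩
  set L := FractionRing (MvPolynomial ℕ K ⧸ P)
  let φ : MvPolynomial ℕ K →ₐ[K] L :=
    (IsScalarTower.toAlgHom K (MvPolynomial ℕ K ⧸ P) L).comp (Ideal.Quotient.mkₐ K P)
  have hφ : ∀ p, φ p = 0 ↔ p ∈ P := fun p => by
    rw [← Ideal.Quotient.eq_zero_iff_mem]
    exact IsFractionRing.to_map_eq_zero_iff (R := MvPolynomial ℕ K ⧸ P) (K := L)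
  let S : Set L := (fun i => φ (MvPolynomial.X i)) '' Set.Iic n
  let E := IntermediateField.adjoin K S
  have hsupp : ∀ m, (∀ i ≤ m, φ (MvPolynomial.X i) ∈ E) →
      ∀ p ∈ MvPolynomial.supported K (Set.Iic m), φ p ∈ E := by
    intro m hm p hp
    have : MvPolynomial.supported K (Set.Iic m) ≤ E.toSubalgebra.comap φ :=
      Algebra.adjoin_le (by rintro _ ⟨i, hi, rfl⟩; exact hm i hi)
    exact this hp
  have hbase : ∀ i ≤ n, φ (MvPolynomial.X i) ∈ E := fun i hi =>
    IntermediateField.subset_adjoin K S ⟨i, hi, rfl⟩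
  have hle : ∀ k, ∀ i ≤ n + k, φ (MvPolynomial.X i) ∈ E := by
    intro k
    induction k with
    | zero => exact hbase
    | succ k ih =>
      intro i hi
      rcases Nat.le_or_eq_of_le_succ hi with hi | hi
      · exact ih i hi
      obtain ⟨g, hg, hgP⟩ := D'.exists_pderiv_mul_X_add_mem hC' hX hPD hf hfP k
      rw [← hφ, map_add, map_mul] at hgP
      have hs0 : φ (MvPolynomial.pderiv n f) ≠ 0 := fun h => hsep ((hφ _).1 h)
      have : φ (MvPolynomial.X (n + k + 1)) = -φ g / φ (MvPolynomial.pderiv n f) := by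
        rw [eq_div_iff hs0]
        linear_combination hgP
      rw [hi, Nat.succ_eq_add_one, Nat.add_eq, this]
      exact div_mem (neg_mem (hsupp _ ih g hg))
        (hsupp n hbase _ (MvPolynomial.pderiv_mem_supported n hf))
  have htop : E = ⊤ := by
    have hall : ∀ p, φ p ∈ E := fun p => by
      have : (⊤ : Subalgebra K (MvPolynomial ℕ K)) ≤ E.toSubalgebra.comap φ := by
        rw [← MvPolynomial.adjoin_range_X]
        exact Algebra.adjoin_le (by
          rintro _ ⟨i, rfl⟩
          exact hle i i (Nat.le_add_left _ _))
      exact this trivial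
    refine eq_top_iff.2 fun x _ => ?_
    obtain ⟨a, b, -, rfl⟩ := IsFractionRing.div_surjective (A := MvPolynomial ℕ K ⧸ P) x
    obtain ⟨a, rfl⟩ := Ideal.Quotient.mk_surjective a
    obtain ⟨b, rfl⟩ := Ideal.Quotient.mk_surjective b
    exact div_mem (hall a) (hall b)
  have hfin : S.Finite := (Set.finite_Iic n).image _
  refine ⟨S.ncard, fun s hs => ?_⟩
  have h := hs.cardinalMk_le_trdeg.trans (trdeg_le_of_adjoin_eq_top S htop)
  rwa [← Set.cast_ncard hfin, Cardinal.mk_coe_finset, Nat.cast_le] at h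
end

section
/- (Jacobi Bound Conjecture in the linear case.) Let K be a field of characteristic zero equipped with a derivation δ : K → K, let n ≥ 1, and let R = MvPolynomial (Fin n × ℕ) K with a derivation ∂ : R → R extending δ on constants and satisfying ∂(X_{(i,r)}) = X_{(i,r+1)} for all i, r (so R is the differential polynomial ring K{x₁,…,x_n} with X_{(i,r)} playing the role of x_i^{(r)}). Let u₁, …, u_n ∈ R each have total degree at most 1 (a linear system of differential equations). Define the order matrix A = (a_{j,i}) with entries in ℤ ∪ {−∞} by a_{j,i} = sup{ r : the variable X_{(i,r)} occurs in u_j } (with sup ∅ = −∞, the strong convention), and the strong Jacobi number J(u₁,…,u_n) = tdet(A) = max_{ρ∈S_n} ∑_{j=1}^n a_{j,ρ(j)}. Let P be a prime ideal of R minimal among prime ideals containing the smallest ∂-stable ideal containing {u₁,…,u_n}, and suppose the fraction field of R/P has finite transcendence degree d over K. Then d, viewed in ℤ ∪ {−∞}, satisfies d ≤ J(u₁,…,u_n). -/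
/-- The strong order matrix of a system `u` of differential polynomials in
`K{x₁,…,x_n} = MvPolynomial (Fin n × ℕ) K`: the `(j,i)` entry is the largest `r` such
that the variable `X (i,r)` (i.e. `x_i^{(r)}`) occurs in `u j`, and `−∞` if no such
variable occurs (the strong convention). -/
noncomputable def orderMatrix {K : Type*} [CommSemiring K] {n : ℕ}
    (u : Fin n → MvPolynomial (Fin n × ℕ) K) : Matrix (Fin n) (Fin n) (WithBot ℤ) :=
  Matrix.of fun j i =>
    ((u j).vars.filter fun p => p.1 = i).sup fun p => ((p.2 : ℤ) : WithBot ℤ)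

/-- Kőnig–Egerváry duality for the optimal assignment problem over the integers. -/
theorem exists_perm_sum_eq_of_cover {ι : Type*} [Fintype ι] [DecidableEq ι]
    (b : ι → ι → ℤ) :
    ∃ (α β : ι → ℤ) (ρ : Equiv.Perm ι),
      (∀ j i, b j i ≤ α j + β i) ∧ ∑ j, b j (ρ j) = ∑ j, α j + ∑ i, β i := by
  classical
  let Q : ℤ → Prop := fun m =>
    ∃ α β : ι → ℤ, (∀ j i, b j i ≤ α j + β i) ∧ ∑ j, α j + ∑ i, β i = m
  have hbdd : ∃ c : ℤ, ∀ m, Q m → c ≤ m := by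
    refine ⟨∑ j, b j j, ?_⟩
    rintro m ⟨α, β, h, rfl⟩
    rw [← Finset.sum_add_distrib]
    exact Finset.sum_le_sum fun j _ => h j j
  have hne : ∃ m, Q m := by
    refine ⟨_, fun j => ∑ i, |b j i|, fun _ => 0, fun j i => ?_, rfl⟩
    rw [add_zero]
    exact (le_abs_self _).trans
      (Finset.single_le_sum (f := fun i => |b j i|) (fun _ _ => abs_nonneg _) (Finset.mem_univ i))
  obtain ⟨m, ⟨α, β, hcov, hm⟩, hmin⟩ := Int.exists_least_of_bdd hbdd hne
  have hall : ∀ S : Finset ι,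
      S.card ≤ (Finset.univ.filter fun i => ∃ j ∈ S, b j i = α j + β i).card := by
    intro S
    by_contra! hlt
    set T := Finset.univ.filter fun i => ∃ j ∈ S, b j i = α j + β i with hT
    have := hmin (m - S.card + T.card)
      ⟨fun j => α j - if j ∈ S then 1 else 0, fun i => β i + if i ∈ T then 1 else 0, ?_, ?_⟩
    · omega
    · intro j i
      have h := hcov j i
      by_cases hj : j ∈ S <;> by_cases hi : i ∈ T <;> simp only [hj, hi, if_true, if_false]
      · omega
      · have : b j i ≠ α j + β i := fun he => hi (by simpa [hT] using ⟨j, hj, he⟩)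
        omega
      · omega
      · omega
    · rw [Finset.sum_sub_distrib, Finset.sum_add_distrib]
      simp only [Finset.sum_ite_mem, Finset.univ_inter, Finset.sum_const, nsmul_eq_mul, mul_one]
      omega
  obtain ⟨f, hf, htight⟩ := (Fintype.all_card_le_filter_rel_iff_exists_injective
    (fun j i => b j i = α j + β i)).1 hall
  let ρ := Equiv.ofBijective f (Finite.injective_iff_bijective.1 hf)
  refine ⟨α, β, ρ, hcov, ?_⟩
  rw [← Equiv.sum_comp ρ β, ← Finset.sum_add_distrib]
  exact Finset.sum_congr rfl fun j _ => htight j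

theorem Submodule.finrank_map_add_finrank_inf_ker {K V W : Type*} [Field K] [AddCommGroup V]
    [Module K V] [AddCommGroup W] [Module K W] (T : V →ₗ[K] W) (A : Submodule K V)
    [Module.Finite K A] :
    Module.finrank K (Submodule.map T A) + Module.finrank K ↥(A ⊓ LinearMap.ker T) =
      Module.finrank K A := by
  rw [← LinearMap.finrank_range_add_finrank_ker (T.domRestrict A), LinearMap.range_domRestrict,
    LinearMap.ker_domRestrict, (Submodule.equivSubtypeMap A (T.ker.comap A.subtype)).finrank_eq,
    Submodule.map_comap_subtype]

/-- The derivation on `K`-linear combinations of the symbols `x_i^{(r)}` that extends the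
additive map `δ` on coefficients and sends `x_i^{(r)}` to `x_i^{(r+1)}`. -/
noncomputable def formDeriv {K : Type*} [Field K] (ι : Type*) (δ : K →+ K) :
    (ι × ℕ →₀ K) →+ (ι × ℕ →₀ K) :=
  Finsupp.mapRange.addMonoidHom δ + Finsupp.mapDomain.addMonoidHom fun p => (p.1, p.2 + 1)

/-- The linear forms involving `x_i^{(r)}` only for `r < f i`. -/
def formsLT (K : Type*) [Field K] {ι : Type*} (f : ι → ℕ) : Submodule K (ι × ℕ →₀ K) :=
  Finsupp.supported K K {p | p.2 < f p.1}

section Forms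

variable {K ι : Type*} [Field K]

theorem formDeriv_single (δ : K →+ K) (p : ι × ℕ) (c : K) :
    formDeriv ι δ (Finsupp.single p c) =
      Finsupp.single p (δ c) + Finsupp.single (p.1, p.2 + 1) c := by
  simp [formDeriv]

theorem formDeriv_apply_succ (δ : K →+ K) (v : ι × ℕ →₀ K) (i : ι) (r : ℕ) :
    formDeriv ι δ v (i, r + 1) = δ (v (i, r + 1)) + v (i, r) := by
  have hinj : Function.Injective fun p : ι × ℕ => (p.1, p.2 + 1) := by
    rintro ⟨a, b⟩ ⟨c, d⟩ h
    simpa using h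
  have := Finsupp.mapDomain_apply hinj v (i, r)
  simp_all [formDeriv]

theorem formDeriv_smul (δ : K →+ K) (hδ : ∀ a b, δ (a * b) = a * δ b + δ a * b)
    (c : K) (v : ι × ℕ →₀ K) :
    formDeriv ι δ (c • v) = c • formDeriv ι δ v + δ c • v := by
  induction v using Finsupp.induction_linear with
  | zero => simp
  | add v w hv hw => rw [smul_add, map_add, hv, hw, map_add]; module
  | single p a =>
    rw [Finsupp.smul_single, formDeriv_single, formDeriv_single, smul_eq_mul, hδ,
      Finsupp.single_add]
    simp only [smul_add, Finsupp.smul_single, smul_eq_mul]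
    abel

theorem mem_formsLT {f : ι → ℕ} {v : ι × ℕ →₀ K} :
    v ∈ formsLT K f ↔ ∀ i r, v (i, r) ≠ 0 → r < f i := by
  simp [formsLT, Finsupp.mem_supported, Set.subset_def]

theorem formsLT_mono {f g : ι → ℕ} (h : f ≤ g) : formsLT K f ≤ formsLT K g :=
  Finsupp.supported_mono fun p hp => lt_of_lt_of_le hp (h p.1)

theorem single_mem_formsLT {f : ι → ℕ} {p : ι × ℕ} (h : p.2 < f p.1) (c : K) :
    Finsupp.single p c ∈ formsLT K f :=
  Finsupp.single_mem_supported K c h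

theorem formsLT_le_iff {f : ι → ℕ} {W : Submodule K (ι × ℕ →₀ K)} :
    formsLT K f ≤ W ↔ ∀ p : ι × ℕ, p.2 < f p.1 → Finsupp.single p 1 ∈ W := by
  rw [formsLT, Finsupp.supported_eq_span_single, Submodule.span_le, Set.image_subset_iff]
  rfl

theorem exists_of_formDeriv_apply_ne_zero (δ : K →+ K) {v : ι × ℕ →₀ K} {i : ι} {r : ℕ}
    (h : formDeriv ι δ v (i, r) ≠ 0) : ∃ s, v (i, s) ≠ 0 ∧ r ≤ s + 1 := by
  rcases r with _ | r
  · refine ⟨0, fun h0 => h ?_, Nat.zero_le _⟩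
    simp [formDeriv, h0, Finsupp.mapDomain_of_notMem_range]
  · rw [formDeriv_apply_succ] at h
    by_cases h0 : v (i, r) = 0
    · exact ⟨r + 1, fun h1 => h (by simp [h0, h1]), by omega⟩
    · exact ⟨r, h0, le_rfl⟩

theorem formDeriv_mem_formsLT (δ : K →+ K) {f : ι → ℕ} {v : ι × ℕ →₀ K}
    (hv : v ∈ formsLT K f) : formDeriv ι δ v ∈ formsLT K (f + 1) := by
  rw [mem_formsLT] at hv ⊢
  intro i r h
  obtain ⟨s, hs, hr⟩ := exists_of_formDeriv_apply_ne_zero δ h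
  exact Nat.lt_succ_of_le (hr.trans (hv i s hs))

theorem iterate_formDeriv_mem_formsLT (δ : K →+ K) {f : ι → ℕ} {v : ι × ℕ →₀ K}
    (hv : v ∈ formsLT K f) (k : ℕ) :
    (formDeriv ι δ)^[k] v ∈ formsLT K fun i => f i + k := by
  induction k with
  | zero => exact hv
  | succ k ih =>
    rw [Function.iterate_succ_apply']
    exact formDeriv_mem_formsLT δ ih

theorem exists_mem_formsLT_const (v : ι × ℕ →₀ K) :
    ∃ m : ℕ, v ∈ formsLT K fun _ => m := by
  refine ⟨v.support.sup Prod.snd + 1, mem_formsLT.2 fun i r h => Nat.lt_succ_of_le ?_⟩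
  exact Finset.le_sup (f := Prod.snd) (Finsupp.mem_support_iff.2 h)

theorem exists_forall_mem_formsLT_const {κ : Type*} [Finite κ] (v : κ → ι × ℕ →₀ K) :
    ∃ m : ℕ, ∀ a, v a ∈ formsLT K fun _ => m := by
  cases nonempty_fintype κ
  choose m hm using fun a => exists_mem_formsLT_const (v a)
  exact ⟨Finset.univ.sup m, fun a =>
    formsLT_mono (fun _ => Finset.le_sup (f := m) (Finset.mem_univ a)) (hm a)⟩

theorem linearIndependent_iterate_formDeriv (δ : K →+ K) {z : ι × ℕ →₀ K} (hz : z ≠ 0)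
    (t : ℕ) : LinearIndependent K fun k : Fin t => (formDeriv ι δ)^[k] z := by
  classical
  obtain ⟨⟨i, r₀⟩, hp⟩ := Finsupp.ne_iff.1 hz
  obtain ⟨m, hm, hmax⟩ : ∃ m, z (i, m) ≠ 0 ∧ ∀ r, m < r → z (i, r) = 0 := by
    have hne : (z.support.filter fun p => p.1 = i).Nonempty := ⟨(i, r₀), by simpa using hp⟩
    obtain ⟨⟨i', m⟩, hmem, hmax⟩ := Finset.exists_max_image _ Prod.snd hne
    obtain ⟨hm, rfl⟩ : z (i', m) ≠ 0 ∧ i' = i := by simpa using hmem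
    refine ⟨m, hm, fun r hr => ?_⟩
    by_contra h
    exact absurd (hmax (i', r) (by simpa using h)) (not_le.2 hr)
  have htop : ∀ k, (formDeriv ι δ)^[k] z (i, m + k) ≠ 0 ∧
      ∀ r, m + k < r → (formDeriv ι δ)^[k] z (i, r) = 0 := by
    intro k
    induction k with
    | zero => exact ⟨hm, hmax⟩
    | succ k ih =>
      simp only [Function.iterate_succ_apply']
      refine ⟨?_, fun r hr => ?_⟩
      · rw [← add_assoc, formDeriv_apply_succ, ih.2 _ (Nat.lt_succ_self _), map_zero, zero_add]
        exact ih.1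
      · obtain ⟨r, rfl⟩ : ∃ r', r = r' + 1 := ⟨r - 1, by omega⟩
        rw [formDeriv_apply_succ, ih.2 _ (by omega), ih.2 _ (by omega), map_zero, zero_add]
  induction t with
  | zero => exact linearIndependent_empty_type
  | succ t ih =>
    rw [linearIndependent_finSucc']
    refine ⟨ih, fun hmem => (htop t).1 ?_⟩
    have hle : Submodule.span K (Set.range (Fin.init fun k : Fin (t + 1) =>
        (formDeriv ι δ)^[k] z)) ≤ LinearMap.ker (Finsupp.lapply (R := K) (i, m + t)) := by
      rw [Submodule.span_le]
      rintro _ ⟨k, rfl⟩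
      exact (htop k).2 _ (by simp)
    exact hle hmem

theorem exists_sup_formsLT_eq_top (N : Submodule K (ι × ℕ →₀ K))
    [Module.Finite K ((ι × ℕ →₀ K) ⧸ N)] :
    ∃ m : ℕ, N ⊔ formsLT K (fun _ => m) = ⊤ := by
  obtain ⟨s, hs⟩ := Module.Finite.fg_top (R := K) (M := (ι × ℕ →₀ K) ⧸ N)
  choose g hg using N.mkQ_surjective
  obtain ⟨m, hm⟩ := exists_forall_mem_formsLT_const fun a : s => g a
  refine ⟨m, ?_⟩
  rw [← Submodule.map_mkQ_eq_top, eq_top_iff, ← hs, Submodule.span_le]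
  exact fun a ha => ⟨g a, hm ⟨a, ha⟩, hg a⟩

variable [Fintype ι]

instance (f : ι → ℕ) : Finite {p : ι × ℕ | p.2 < f p.1} :=
  Finite.of_injective (β := Σ i, Fin (f i)) (fun p => ⟨p.1.1, ⟨p.1.2, p.2⟩⟩) (by
    rintro ⟨⟨a, b⟩, h⟩ ⟨⟨c, d⟩, h'⟩ he
    simp only [Sigma.mk.injEq] at he
    obtain ⟨rfl, he⟩ := he
    simpa using he)

instance (f : ι → ℕ) : Module.Finite K (formsLT K f) :=
  Module.Finite.equiv (Finsupp.supportedEquivFinsupp {p : ι × ℕ | p.2 < f p.1}).symm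

theorem finrank_formsLT (f : ι → ℕ) : Module.finrank K (formsLT K f) = ∑ i, f i := by
  have e : {p : ι × ℕ | p.2 < f p.1} ≃ Σ i, Fin (f i) :=
    { toFun := fun p => ⟨p.1.1, ⟨p.1.2, p.2⟩⟩
      invFun := fun q => ⟨(q.1, q.2), q.2.2⟩
      left_inv := fun _ => rfl
      right_inv := fun _ => rfl }
  rw [formsLT, (Finsupp.supportedEquivFinsupp {p : ι × ℕ | p.2 < f p.1}).finrank_eq,
    (Finsupp.domLCongr e).finrank_eq, Module.finrank_finsupp_self]
  simp

/-- An endomorphism commuting with the derivation and having finite-dimensional cokernel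
is injective. -/
theorem injective_of_finite_coker (δ : K →+ K) (T : (ι × ℕ →₀ K) →ₗ[K] (ι × ℕ →₀ K))
    (hT : ∀ v, T (formDeriv ι δ v) = formDeriv ι δ (T v))
    [Module.Finite K ((ι × ℕ →₀ K) ⧸ LinearMap.range T)] : Function.Injective T := by
  rw [← LinearMap.ker_eq_bot, Submodule.eq_bot_iff]
  intro z hz
  by_contra hz0
  obtain ⟨r, hr⟩ := exists_sup_formsLT_eq_top (LinearMap.range T)
  have hdec : ∀ i, ∃ v, ∃ w ∈ formsLT K (fun _ : ι => r), T v + w = Finsupp.single (i, r) 1 := by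
    intro i
    have : Finsupp.single (i, r) (1 : K) ∈ LinearMap.range T ⊔ formsLT K (fun _ => r) := by
      rw [hr]; trivial
    obtain ⟨_, ⟨v, rfl⟩, w, hw, h⟩ := Submodule.mem_sup.1 this
    exact ⟨v, w, hw, h⟩
  choose v w hw hvw using hdec
  obtain ⟨s, hs⟩ := exists_forall_mem_formsLT_const v
  obtain ⟨q, hq⟩ := exists_mem_formsLT_const z
  have hsucc : formsLT K (fun _ : ι => r + 1) ≤
      (formsLT K fun _ => s).map T ⊔ formsLT K fun _ => r := by
    rw [formsLT_le_iff]
    rintro ⟨i, k⟩ hk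
    rcases (Nat.lt_succ_iff_lt_or_eq.1 hk) with hk | rfl
    · exact Submodule.mem_sup_right (single_mem_formsLT hk 1)
    · rw [← hvw i]
      exact Submodule.add_mem_sup ⟨_, hs i, rfl⟩ (hw i)
  have hle : ∀ m, formsLT K (fun _ : ι => r + m) ≤
      (formsLT K fun _ => s + m).map T ⊔ formsLT K fun _ => r := by
    intro m
    induction m with
    | zero => exact le_sup_right
    | succ m ih =>
      rw [formsLT_le_iff]
      rintro ⟨i, k⟩ hk
      have hs' : formsLT K (fun _ : ι => r + 1) ≤
          (formsLT K fun _ => s + (m + 1)).map T ⊔ formsLT K fun _ => r := by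
        refine hsucc.trans (sup_le_sup_right (Submodule.map_mono (formsLT_mono fun _ => ?_)) _)
        exact Nat.le_add_right _ _
      have hsm : (formsLT K fun _ => s + m).map T ⊔ formsLT K (fun _ => r) ≤
          (formsLT K fun _ => s + (m + 1)).map T ⊔ formsLT K fun _ => r := by
        refine sup_le_sup_right (Submodule.map_mono (formsLT_mono fun _ => ?_)) _
        exact Nat.le_succ _
      by_cases hkr : k < r + 1
      · exact hs' (single_mem_formsLT hkr 1)
      obtain ⟨k, rfl⟩ : ∃ k', k = k' + 1 := ⟨k - 1, by omega⟩
      have hk' : Finsupp.single (i, k) (1 : K) ∈ formsLT K (fun _ : ι => r + m) :=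
        single_mem_formsLT (by simp only at hk ⊢; omega) 1
      obtain ⟨_, ⟨a, ha, rfl⟩, b, hb, hab⟩ := Submodule.mem_sup.1 (ih hk')
      have hδ1 : formDeriv ι δ (Finsupp.single (i, k) (1 : K)) - Finsupp.single (i, k) (δ 1) =
          Finsupp.single (i, k + 1) 1 := by
        rw [formDeriv_single, add_sub_cancel_left]
      rw [← hδ1, ← hab, map_add, ← hT]
      refine Submodule.sub_mem _ (Submodule.add_mem _ (Submodule.mem_sup_left
        ⟨_, formDeriv_mem_formsLT δ ha, rfl⟩) (hs' (formDeriv_mem_formsLT δ hb))) ?_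
      have hmem : Finsupp.single (i, k) (δ 1) ∈ formsLT K (fun _ : ι => r + m) :=
        single_mem_formsLT (by simp only at hk ⊢; omega) _
      exact hsm (ih hmem)
  set m := Fintype.card ι * (s + q) + 1 with hm
  set A := formsLT K (fun _ : ι => s + q + m) with hA
  have h1 : Fintype.card ι * (r + m) ≤
      Module.finrank K (Submodule.map T A) + Fintype.card ι * r := by
    have hA' : (formsLT K fun _ => s + m).map T ≤ A.map T := by
      refine Submodule.map_mono (formsLT_mono fun _ => ?_)
      simp only
      omega
    calc Fintype.card ι * (r + m) = Module.finrank K (formsLT K fun _ : ι => r + m) := by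
          simp [finrank_formsLT]
      _ ≤ Module.finrank K ↥(A.map T ⊔ formsLT K fun _ : ι => r) :=
          Submodule.finrank_mono ((hle m).trans (sup_le_sup hA' le_rfl))
      _ ≤ _ := (Submodule.finrank_add_le_finrank_add_finrank _ _).trans
          (by simp [finrank_formsLT])
  have h2 : m ≤ Module.finrank K ↥(A ⊓ LinearMap.ker T) := by
    have hker : ∀ k, T ((formDeriv ι δ)^[k] z) = 0 := by
      intro k
      induction k with
      | zero => exact hz
      | succ k ih => rw [Function.iterate_succ_apply', hT, ih, map_zero]
    have hmem : ∀ k : Fin m, (formDeriv ι δ)^[k] z ∈ A := fun k =>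
      formsLT_mono (fun _ => by have := k.2; simp only; omega) (iterate_formDeriv_mem_formsLT δ hq k)
    let y : Fin m → ↥(A ⊓ LinearMap.ker T) := fun k => ⟨_, hmem k, hker k⟩
    have hy : LinearIndependent K y :=
      LinearIndependent.of_comp (Submodule.subtype _)
        (linearIndependent_iterate_formDeriv δ hz0 m)
    simpa using hy.fintype_card_le_finrank
  have h3 := Submodule.finrank_map_add_finrank_inf_ker T A
  rw [hA, finrank_formsLT, ← hA] at h3
  simp only [Finset.sum_const, Finset.card_univ, smul_eq_mul] at h3
  rw [mul_add] at h1
  rw [mul_add] at h3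
  omega

/-- The dimension of the cokernel of a system of linear differential forms is bounded by
a transversal of any integer matrix dominating the orders. -/
theorem exists_perm_finrank_coker_le [DecidableEq ι] (δ : K →+ K)
    (T : (ι × ℕ →₀ K) →ₗ[K] (ι × ℕ →₀ K))
    (hT : ∀ v, T (formDeriv ι δ v) = formDeriv ι δ (T v))
    [Module.Finite K ((ι × ℕ →₀ K) ⧸ LinearMap.range T)] (b : ι → ι → ℤ)
    (hb : ∀ j k i r, T (Finsupp.single (j, k) 1) (i, r) ≠ 0 → (r : ℤ) ≤ b j i + k) :
    ∃ ρ : Equiv.Perm ι,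
      (Module.finrank K ((ι × ℕ →₀ K) ⧸ LinearMap.range T) : ℤ) ≤ ∑ j, b j (ρ j) := by
  obtain ⟨α, β, ρ, hcov, hsum⟩ := exists_perm_sum_eq_of_cover b
  refine ⟨ρ, ?_⟩
  rw [hsum]
  obtain ⟨m, hm⟩ := exists_sup_formsLT_eq_top (LinearMap.range T)
  obtain ⟨t, ht⟩ : ∃ t : ℤ, ∀ i, 0 ≤ t - α i ∧ (m : ℤ) ≤ t + β i := by
    refine ⟨∑ i, (|α i| + (m + |β i|)), fun i => ?_⟩
    have := Finset.single_le_sum (f := fun i => |α i| + ((m : ℤ) + |β i|))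
      (fun _ _ => by positivity) (Finset.mem_univ i)
    have h1 := le_abs_self (α i)
    have h2 := neg_abs_le (β i)
    have h3 := abs_nonneg (α i)
    have h4 := abs_nonneg (β i)
    constructor <;> omega
  set A := formsLT K fun i => (t + β i).toNat with hA
  set B := formsLT K fun j => (t - α j).toNat with hB
  have hBA : B.map T ≤ A := by
    rw [Submodule.map_le_iff_le_comap, hB, formsLT_le_iff]
    rintro ⟨j, k⟩ hk
    change T _ ∈ A
    refine mem_formsLT.2 fun i r h => ?_
    have := hb j k i r h
    have := hcov j i
    have := ht i
    simp only at hk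
    omega
  have hAtop : A.map (LinearMap.range T).mkQ = ⊤ := by
    have hmA : formsLT K (fun _ => m) ≤ A := by
      refine formsLT_mono fun i => ?_
      have := ht i
      simp only
      omega
    have hsup : LinearMap.range T ⊔ A = ⊤ := top_le_iff.1 (hm ▸ sup_le_sup_left hmA _)
    exact (Submodule.map_mkQ_eq_top _ _).2 hsup
  have hker : Module.finrank K (B.map T) ≤
      Module.finrank K ↥(A ⊓ LinearMap.ker (LinearMap.range T).mkQ) := by
    refine Submodule.finrank_mono (le_inf hBA ?_)
    rw [Submodule.ker_mkQ]
    exact LinearMap.map_le_range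
  have hdim := Submodule.finrank_map_add_finrank_inf_ker (LinearMap.range T).mkQ A
  rw [hAtop, finrank_top] at hdim
  rw [(Submodule.equivMapOfInjective T (injective_of_finite_coker δ T hT) B).finrank_eq.symm]
    at hker
  rw [hA, finrank_formsLT, ← hA] at hdim
  rw [hB, finrank_formsLT] at hker
  zify at hker hdim
  simp only [fun i => Int.toNat_of_nonneg (ht i).1,
    fun i => Int.toNat_of_nonneg ((Int.natCast_nonneg m).trans (ht i).2)] at hker hdim
  rw [Finset.sum_sub_distrib] at hker
  rw [Finset.sum_add_distrib] at hdim
  linarith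

end Forms

/-- The linear form with given coefficients, as a polynomial. -/
noncomputable def linForm (σ K : Type*) [Field K] : (σ →₀ K) →ₗ[K] MvPolynomial σ K :=
  Finsupp.linearCombination K MvPolynomial.X

theorem linForm_single {σ K : Type*} [Field K] (p : σ) (c : K) :
    linForm σ K (Finsupp.single p c) = MvPolynomial.C c * MvPolynomial.X p := by
  simp [linForm, MvPolynomial.smul_eq_C_mul]

theorem coeff_linForm {σ K : Type*} [Field K] [DecidableEq σ] (v : σ →₀ K) (m : σ →₀ ℕ) :
    (linForm σ K v).coeff m = v.sum fun p a => if Finsupp.single p 1 = m then a else 0 := by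
  simp only [linForm, Finsupp.linearCombination_apply, Finsupp.sum, MvPolynomial.coeff_sum,
    MvPolynomial.coeff_smul, MvPolynomial.coeff_X, smul_eq_mul, mul_ite, mul_one, mul_zero]

theorem exists_eq_C_add_linForm {σ K : Type*} [Field K] {u : MvPolynomial σ K}
    (hu : u.totalDegree ≤ 1) :
    ∃ (c : K) (v : σ →₀ K), u = MvPolynomial.C c + linForm σ K v ∧ v.support ⊆ u.vars := by
  classical
  have hsupp : ∀ p, MvPolynomial.coeff (Finsupp.single p 1) u ≠ 0 → p ∈ u.vars := by
    intro p hp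
    exact (MvPolynomial.mem_vars_iff_mem_support p).2 ⟨_, MvPolynomial.mem_support_iff.2 hp, by simp⟩
  refine ⟨u.coeff 0, Finsupp.onFinset u.vars (fun p => u.coeff (Finsupp.single p 1)) hsupp, ?_,
    Finsupp.support_onFinset_subset⟩
  ext m
  rw [MvPolynomial.coeff_add, MvPolynomial.coeff_C, coeff_linForm]
  rcases Nat.lt_or_ge 1 m.degree with h | h
  · rw [MvPolynomial.coeff_eq_zero_of_totalDegree_lt (lt_of_le_of_lt hu h), if_neg, zero_add,
      Finsupp.sum, Finset.sum_eq_zero]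
    · rintro p -
      rw [if_neg]
      rintro rfl
      simp at h
    · rintro rfl
      simp at h
  · rcases eq_or_ne m 0 with rfl | hm
    · simp [Finsupp.sum]
    · obtain ⟨p, hp⟩ := Finsupp.ne_iff.1 hm
      obtain ⟨m', rfl⟩ := le_iff_exists_add.1
        (Finsupp.single_le_iff.2 (Nat.one_le_iff_ne_zero.2 hp))
      obtain rfl : m' = 0 := by
        rw [← Finsupp.degree_eq_zero_iff]
        simpa using h
      rw [add_zero] at hm ⊢
      rw [if_neg hm.symm, zero_add]
      simp only [Finsupp.single_left_inj one_ne_zero]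
      rw [Finsupp.sum_ite_eq']
      simp +contextual [eq_comm]

/-- An ideal generated by polynomials of degree at most one is either trivial or the kernel
of a surjection onto the polynomial ring whose variables form a basis of the space of linear forms modulo
the homogeneous parts of the generators. -/
theorem exists_surjective_ker_eq_span {σ κ K : Type*} [Field K] (ℓ : κ → σ →₀ K) (c : κ → K)
    (I : Ideal (MvPolynomial σ K))
    (hspan : I = Ideal.span (Set.range fun k => MvPolynomial.C (c k) + linForm σ K (ℓ k)))
    (hI : I ≠ ⊤) {β : Type*}
    (B : Module.Basis β K ((σ →₀ K) ⧸ Submodule.span K (Set.range ℓ))) :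
    ∃ φ : MvPolynomial σ K →ₐ[K] MvPolynomial β K,
      Function.Surjective φ ∧ RingHom.ker φ = I := by
  set N := Submodule.span K (Set.range ℓ)
  have hgen : ∀ k, MvPolynomial.C (c k) + linForm σ K (ℓ k) ∈ I := fun k =>
    hspan ▸ Ideal.subset_span ⟨k, rfl⟩
  obtain ⟨f, hf1, hf⟩ : ∃ f : MvPolynomial σ K →ₗ[K] K, f 1 = 1 ∧ ∀ x ∈ I, f x = 0 := by
    obtain ⟨f, hf1, hf⟩ := Submodule.exists_le_ker_of_notMem (p := I.restrictScalars K)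
      (v := (1 : MvPolynomial σ K)) (fun h => hI ((Ideal.eq_top_iff_one _).2 h))
    exact ⟨(f 1)⁻¹ • f, by simp [hf1], fun x hx => by
      have : f x = 0 := hf hx
      simp [this]⟩
  let lam : (σ →₀ K) →ₗ[K] K := f ∘ₗ linForm σ K
  have hlam : ∀ k, c k + lam (ℓ k) = 0 := by
    intro k
    have := hf _ (hgen k)
    rwa [map_add, ← mul_one (MvPolynomial.C (c k)), ← MvPolynomial.smul_eq_C_mul, map_smul, hf1,
      smul_eq_mul, mul_one] at this
  let e := B.constr K (MvPolynomial.X (R := K) (σ := β))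
  let φ : MvPolynomial σ K →ₐ[K] MvPolynomial β K :=
    MvPolynomial.aeval fun p => e (N.mkQ (Finsupp.single p 1)) +
      MvPolynomial.C (lam (Finsupp.single p 1))
  have hφ : ∀ v, φ (linForm σ K v) = e (N.mkQ v) + MvPolynomial.C (lam v) := by
    intro v
    have : φ.toLinearMap ∘ₗ linForm σ K =
        e ∘ₗ N.mkQ + (Algebra.linearMap K (MvPolynomial β K)) ∘ₗ lam := by
      ext p : 2
      simp [φ, linForm_single, MvPolynomial.algebraMap_eq]
    exact LinearMap.congr_fun this v
  let g₀ : (σ →₀ K) →ₗ[K] MvPolynomial σ K ⧸ I :=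
    (Ideal.Quotient.mkₐ K I).toLinearMap ∘ₗ
      (linForm σ K - (Algebra.linearMap K (MvPolynomial σ K)) ∘ₗ lam)
  have hg₀ : N ≤ LinearMap.ker g₀ := by
    rw [Submodule.span_le]
    rintro _ ⟨k, rfl⟩
    refine Ideal.Quotient.eq_zero_iff_mem.2 ?_
    have : linForm σ K (ℓ k) - MvPolynomial.C (lam (ℓ k)) =
        MvPolynomial.C (c k) + linForm σ K (ℓ k) := by
      rw [eq_neg_of_add_eq_zero_left (hlam k), map_neg]
      ring
    simpa [MvPolynomial.algebraMap_eq, this] using hgen k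
  let g := N.liftQ g₀ hg₀
  let ψ : MvPolynomial β K →ₐ[K] MvPolynomial σ K ⧸ I := MvPolynomial.aeval fun b => g (B b)
  have hψ : ∀ q, ψ (e q) = g q := by
    intro q
    have : ψ.toLinearMap ∘ₗ e = g := B.ext fun b => by simp [ψ, e]
    exact LinearMap.congr_fun this q
  have hψφ : ψ.comp φ = Ideal.Quotient.mkₐ K I := by
    ext p
    have : φ (MvPolynomial.X p) = e (N.mkQ (Finsupp.single p 1)) +
      MvPolynomial.C (lam (Finsupp.single p 1)) := MvPolynomial.aeval_X _ _
    rw [AlgHom.comp_apply, this, map_add, hψ]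
    have hc : ψ (MvPolynomial.C (lam (Finsupp.single p 1))) =
      Ideal.Quotient.mk I (MvPolynomial.C (lam (Finsupp.single p 1))) := ψ.commutes _
    rw [hc]
    simp [g, g₀, linForm_single, MvPolynomial.algebraMap_eq]
  refine ⟨φ, ?_, le_antisymm ?_ ?_⟩
  · rw [← AlgHom.range_eq_top, eq_top_iff, ← MvPolynomial.adjoin_range_X, Algebra.adjoin_le_iff]
    rintro _ ⟨b, rfl⟩
    obtain ⟨v, hv⟩ := N.mkQ_surjective (B b)
    refine ⟨linForm σ K v - MvPolynomial.C (lam v), ?_⟩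
    have hc : φ (MvPolynomial.C (lam v)) = MvPolynomial.C (lam v) := φ.commutes _
    change φ _ = _
    rw [map_sub, hφ, hv, hc, add_sub_cancel_right]
    exact B.constr_basis _ _ _
  · intro x hx
    have := AlgHom.congr_fun hψφ x
    rw [AlgHom.comp_apply, (show φ x = 0 from hx), map_zero] at this
    exact Ideal.Quotient.eq_zero_iff_mem.1 this.symm
  · rw [hspan, Ideal.span_le]
    rintro _ ⟨k, rfl⟩
    have hc : φ (MvPolynomial.C (c k)) = MvPolynomial.C (c k) := φ.commutes _
    have hN : N.mkQ (ℓ k) = 0 :=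
      (Submodule.Quotient.mk_eq_zero _).2 (Submodule.subset_span ⟨k, rfl⟩)
    change φ _ = 0
    rw [map_add, hφ, hc, hN, map_zero, zero_add, ← map_add, hlam, map_zero]

/-- If `A` is a polynomial ring over `K` in variables indexed by `β` and the fraction field of `A`
has finite transcendence degree `d`, then `d` is at most the cardinality of `β`. -/
theorem finite_and_le_natCard_of_algEquiv {A β K : Type*} [Field K] [CommRing A] [IsDomain A]
    [Algebra K A] (e : A ≃ₐ[K] MvPolynomial β K) (d : ℕ)
    (hub : ∀ s : Finset (FractionRing A),
      AlgebraicIndependent K ((↑) : s → FractionRing A) → s.card ≤ d)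
    (hex : ∃ s : Finset (FractionRing A),
      AlgebraicIndependent K ((↑) : s → FractionRing A) ∧ s.card = d) :
    Finite β ∧ d ≤ Nat.card β := by
  classical
  have : Algebra.IsAlgebraic A (FractionRing A) :=
    IsLocalization.isAlgebraic (FractionRing A) (nonZeroDivisors A)
  have hy := (e.symm.isTranscendenceBasis (IsTranscendenceBasis.mvPolynomial β K)).algebraMap_comp
    (A := FractionRing A)
  have hfin : Finite β := by
    by_contra hinf
    rw [not_finite_iff_infinite] at hinf
    obtain ⟨s, hs⟩ := Infinite.exists_subset_card_eq β (d + 1)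
    have hle := hub (s.map ⟨_, hy.1.injective⟩) ?_
    · rw [Finset.card_map, hs] at hle
      omega
    · refine hy.1.coe_range.mono (t := ↑(s.map ⟨_, hy.1.injective⟩)) ?_
      intro x hx
      obtain ⟨b, -, rfl⟩ := Finset.mem_map.1 hx
      exact ⟨b, rfl⟩
  refine ⟨hfin, ?_⟩
  obtain ⟨s, hs, rfl⟩ := hex
  have h1 := hs.cardinalMk_le_trdeg
  have h2 := hy.lift_cardinalMk_eq_trdeg
  rw [← Cardinal.lift_le, ← h2, ← Nat.cast_card (α := β)] at h1
  simpa using h1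

theorem exists_of_iterate_formDeriv_apply_ne_zero {K ι : Type*} [Field K] (δ : K →+ K)
    {v : ι × ℕ →₀ K} (k : ℕ) :
    ∀ {i : ι} {r : ℕ}, (formDeriv ι δ)^[k] v (i, r) ≠ 0 → ∃ s, v (i, s) ≠ 0 ∧ r ≤ s + k := by
  induction k with
  | zero => exact fun {i r} h => ⟨r, h, le_rfl⟩
  | succ k ih =>
    intro i r h
    rw [Function.iterate_succ_apply'] at h
    obtain ⟨r', h', hr⟩ := exists_of_formDeriv_apply_ne_zero δ h
    obtain ⟨s, hs, hrs⟩ := ih h'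
    exact ⟨s, hs, by omega⟩

/-- The differential ideal generated by `S` is generated, as an ideal, by the derivatives of the
elements of `S`. -/
theorem diffIdealClosure_range_eq_span {R κ : Type*} [CommRing R] (D : R → R)
    (hadd : ∀ p q, D (p + q) = D p + D q) (hleib : ∀ p q, D (p * q) = p * D q + D p * q)
    (u : κ → R) :
    diffIdealClosure D (Set.range u) =
      Ideal.span (Set.range fun p : κ × ℕ => D^[p.2] (u p.1)) := by
  refine le_antisymm (sInf_le ⟨?_, fun x hx => ?_⟩) ?_
  · rintro _ ⟨j, rfl⟩
    exact Ideal.subset_span ⟨(j, 0), rfl⟩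
  · induction hx using Submodule.span_induction with
    | mem x hx =>
      obtain ⟨⟨j, k⟩, rfl⟩ := hx
      exact Ideal.subset_span ⟨(j, k + 1), Function.iterate_succ_apply' _ _ _⟩
    | zero =>
      have : D 0 = 0 := by simpa using hadd 0 0
      rw [this]
      exact zero_mem _
    | add x y _ _ hx hy => rw [hadd]; exact add_mem hx hy
    | smul a x hxm hx =>
      rw [smul_eq_mul, hleib]
      exact add_mem (Ideal.mul_mem_left _ _ hx) (Ideal.mul_mem_left _ _ hxm)
  · refine le_sInf fun J hJ => Ideal.span_le.2 ?_
    rintro _ ⟨⟨j, k⟩, rfl⟩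
    simp only
    induction k with
    | zero => exact hJ.1 ⟨j, rfl⟩
    | succ k ih =>
      rw [Function.iterate_succ_apply']
      exact hJ.2 _ ih

/-- If every integer matrix obtained from `A` by replacing `-∞` with a sufficiently negative integer
has a transversal of sum at least `d ≥ 0`, then `d` is at most the tropical determinant of `A`. -/
theorem natCast_le_tdet_of_forall_exists {ι : Type*} [Fintype ι] [DecidableEq ι]
    (A : Matrix ι ι (WithBot ℤ)) (d : ℕ)
    (h : ∀ L : ℤ, ∃ ρ : Equiv.Perm ι, (d : ℤ) ≤ ∑ j, (A j (ρ j)).unbotD L) :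
    ((d : ℤ) : WithBot ℤ) ≤ tdet A := by
  set M : ι → ℤ := fun j => ∑ i, |(A j i).unbotD 0| with hM
  have hM0 : ∀ j, 0 ≤ M j := fun j => Finset.sum_nonneg fun _ _ => abs_nonneg _
  have hML : ∀ j i, A j i ≠ ⊥ → ∀ L, (A j i).unbotD L ≤ M j := by
    intro j i hne L
    obtain ⟨a, ha⟩ := WithBot.ne_bot_iff_exists.1 hne
    have := Finset.single_le_sum (f := fun i => |(A j i).unbotD 0|) (fun _ _ => abs_nonneg _)
      (Finset.mem_univ i)
    simp only [← ha, WithBot.unbotD_coe] at this ⊢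
    exact (le_abs_self a).trans this
  obtain ⟨ρ, hρ⟩ := h (-(∑ j, M j) - 1)
  have hsum : 0 ≤ ∑ j, M j := Finset.sum_nonneg fun j _ => hM0 j
  have hne : ∀ j, A j (ρ j) ≠ ⊥ := by
    intro j hj
    rw [← Finset.add_sum_erase _ _ (Finset.mem_univ j), hj, WithBot.unbotD_bot] at hρ
    have h1 : ∑ k ∈ Finset.univ.erase j, (A k (ρ k)).unbotD (-(∑ j, M j) - 1) ≤
        ∑ k ∈ Finset.univ.erase j, M k := by
      refine Finset.sum_le_sum fun k _ => ?_
      by_cases hk : A k (ρ k) = ⊥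
      · rw [hk, WithBot.unbotD_bot]
        linarith [hM0 k]
      · exact hML k _ hk _
    have h2 := Finset.add_sum_erase Finset.univ M (Finset.mem_univ j)
    have := hM0 j
    omega
  refine le_trans ?_ (Finset.le_sup (f := fun ρ : Equiv.Perm ι => ∑ i, A i (ρ i))
    (Finset.mem_univ ρ))
  have hcoe : ∑ j, A j (ρ j) = ((∑ j, (A j (ρ j)).unbotD (-(∑ j, M j) - 1) : ℤ) : WithBot ℤ) := by
    rw [WithBot.coe_sum]
    refine Finset.sum_congr rfl fun j _ => ?_
    obtain ⟨a, ha⟩ := WithBot.ne_bot_iff_exists.1 (hne j)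
    rw [← ha, WithBot.unbotD_coe]
  simp only [hcoe]
  exact_mod_cast hρ

/-- **The Jacobi Bound Conjecture in the linear case.**
Let `K` be a field of characteristic zero with derivation `δ` and let
`R = MvPolynomial (Fin n × ℕ) K` be the differential polynomial ring `K{x₁,…,x_n}`
(with `X (i,r)` playing the role of `x_i^{(r)}`), equipped with a derivation `D`
extending `δ` and sending `X (i,r) ↦ X (i,r+1)`.  Let `u₁, …, u_n` be a linear system
(total degree at most `1`), let `P` be a minimal prime over the differential ideal
`[{u₁,…,u_n}]`, and suppose the fraction field of `R ⧸ P` has finite transcendence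
degree `d` over `K` (expressed by: every algebraically independent finite subset has
cardinality at most `d`, and some such subset has cardinality `d`).  Then
`d ≤ J(u₁,…,u_n)`, the strong Jacobi number, i.e. the tropical determinant of the
strong order matrix. -/
theorem jacobi_bound_linear_case
    (K : Type*) [Field K] [CharZero K] (δ : K → K)
    (hδadd : ∀ a b, δ (a + b) = δ a + δ b)
    (hδleib : ∀ a b, δ (a * b) = a * δ b + δ a * b)
    (n : ℕ) (hn : 1 ≤ n)
    (D : MvPolynomial (Fin n × ℕ) K → MvPolynomial (Fin n × ℕ) K)
    (hadd : ∀ p q, D (p + q) = D p + D q)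
    (hleib : ∀ p q, D (p * q) = p * D q + D p * q)
    (hC : ∀ a : K, D (MvPolynomial.C a) = MvPolynomial.C (δ a))
    (hX : ∀ (i : Fin n) (r : ℕ),
      D (MvPolynomial.X (i, r)) = MvPolynomial.X (i, r + 1))
    (u : Fin n → MvPolynomial (Fin n × ℕ) K)
    (hlin : ∀ j, (u j).totalDegree ≤ 1)
    (P : Ideal (MvPolynomial (Fin n × ℕ) K))
    (hP : P ∈ (diffIdealClosure D (Set.range u)).minimalPrimes)
    (d : ℕ)
    (hub : ∀ s : Finset (FractionRing (MvPolynomial (Fin n × ℕ) K ⧸ P)),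
      AlgebraicIndependent K ((↑) : s → FractionRing (MvPolynomial (Fin n × ℕ) K ⧸ P)) →
      s.card ≤ d)
    (hex : ∃ s : Finset (FractionRing (MvPolynomial (Fin n × ℕ) K ⧸ P)),
      AlgebraicIndependent K ((↑) : s → FractionRing (MvPolynomial (Fin n × ℕ) K ⧸ P)) ∧
      s.card = d) :
    ((d : ℤ) : WithBot ℤ) ≤ tdet (orderMatrix u) := by
  let δ' : K →+ K := AddMonoidHom.mk' δ hδadd
  have hD0 : D 0 = 0 := by simpa using hadd 0 0
  have hDlin : ∀ v, D (linForm (Fin n × ℕ) K v) =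
      linForm (Fin n × ℕ) K (formDeriv (Fin n) δ' v) := by
    intro v
    induction v using Finsupp.induction_linear with
    | zero => simp [hD0]
    | add v w hv hw => rw [map_add, hadd, hv, hw, map_add, map_add]
    | single p a =>
      rw [linForm_single, hleib, hC, hX, formDeriv_single, map_add, linForm_single,
        linForm_single, add_comm]
      rfl
  choose c v hu hv using fun j => exists_eq_C_add_linForm (hlin j)
  let ℓ : Fin n × ℕ → Fin n × ℕ →₀ K := fun p => (formDeriv (Fin n) δ')^[p.2] (v p.1)
  have hiter : ∀ p : Fin n × ℕ, D^[p.2] (u p.1) =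
      MvPolynomial.C (δ^[p.2] (c p.1)) + linForm (Fin n × ℕ) K (ℓ p) := by
    rintro ⟨j, k⟩
    simp only [ℓ]
    induction k with
    | zero => exact hu j
    | succ k ih =>
      simp only [Function.iterate_succ_apply']
      rw [ih, hadd, hC, hDlin]
  have hspan := diffIdealClosure_range_eq_span D hadd hleib u
  simp only [hiter] at hspan
  set I := diffIdealClosure D (Set.range u)
  have hPprime : P.IsPrime := hP.1.1
  have hI : I ≠ ⊤ := fun h => hPprime.ne_top (top_le_iff.1 (h ▸ hP.1.2))
  let T : (Fin n × ℕ →₀ K) →ₗ[K] Fin n × ℕ →₀ K :=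
    Finsupp.linearCombination K ℓ
  have hTrange : LinearMap.range T = Submodule.span K (Set.range ℓ) :=
    Finsupp.range_linearCombination K
  let B := Module.Basis.ofVectorSpace K ((Fin n × ℕ →₀ K) ⧸ Submodule.span K (Set.range ℓ))
  obtain ⟨φ, hφ, hker⟩ := exists_surjective_ker_eq_span ℓ _ I hspan hI B
  have hIprime : I.IsPrime := hker ▸ RingHom.ker_isPrime φ
  obtain rfl : P = I := le_antisymm (hP.2 ⟨hIprime, le_rfl⟩ hP.1.2) hP.1.2
  let e := (Ideal.quotientEquivAlgOfEq K hker.symm).trans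
    (Ideal.quotientKerAlgEquivOfSurjective hφ)
  obtain ⟨hfin, hd⟩ := finite_and_le_natCard_of_algEquiv e d hub hex
  rw [← Module.finrank_eq_nat_card_basis B, ← hTrange] at hd
  have hfinite : Module.Finite K ((Fin n × ℕ →₀ K) ⧸ LinearMap.range T) := by
    rw [hTrange]
    exact Module.Finite.of_basis B
  have hTsingle : ∀ p a, T (Finsupp.single p a) = a • ℓ p := fun p a =>
    Finsupp.linearCombination_single K a p
  have hT : ∀ w, T (formDeriv (Fin n) δ' w) = formDeriv (Fin n) δ' (T w) := by
    intro w
    induction w using Finsupp.induction_linear with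
    | zero => simp
    | add v w hv hw => simp only [map_add, hv, hw]
    | single p a =>
      have hℓ : ℓ (p.1, p.2 + 1) = formDeriv (Fin n) δ' (ℓ p) :=
        Function.iterate_succ_apply' _ _ _
      rw [formDeriv_single, map_add]
      rw [hTsingle, hTsingle, hTsingle, formDeriv_smul δ' hδleib, hℓ, add_comm]
  refine natCast_le_tdet_of_forall_exists _ d fun L => ?_
  obtain ⟨ρ, hρ⟩ := exists_perm_finrank_coker_le δ' T hT
    (fun j i => (orderMatrix u j i).unbotD L) (by
      intro j k i r h
      rw [hTsingle, one_smul] at h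
      obtain ⟨s, hs, hrs⟩ := exists_of_iterate_formDeriv_apply_ne_zero δ' k h
      have hmem : (i, s) ∈ (u j).vars := hv j (Finsupp.mem_support_iff.2 hs)
      have hle : ((s : ℤ) : WithBot ℤ) ≤ orderMatrix u j i := by
        rw [orderMatrix, Matrix.of_apply]
        exact Finset.le_sup (f := fun p : Fin n × ℕ => ((p.2 : ℤ) : WithBot ℤ))
          (b := (i, s)) (Finset.mem_filter.2 ⟨hmem, rfl⟩)
      cases ha : orderMatrix u j i with
      | bot => simp [ha] at hle
      | coe a =>
        rw [ha, WithBot.coe_le_coe] at hle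
        rw [WithBot.unbotD_coe]
        omega)
  exact ⟨ρ, le_trans (by exact_mod_cast hd) hρ⟩
end
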